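/- Fix β ∈ ℝ. For each n, let ((X_{n,1},Y_{n,1}),…,(X_{n,n},Y_{n,n})) be distributed according to the Boltzmann–Gibbs measure μ_{n,λ_β×λ_β,β}, and let σ̃_n be the random empirical probability measure σ̃_n(A) = (1/n) Σ_{i=1}^n 1{(X_{n,i},Y_{n,i}) ∈ A}. Then σ̃_n converges in distribution, relative to the weak topology on Borel probability measures on ℝ², to the non-random measure σ_β. -/

import Mathlib

open Filter MeasureTheory
open scoped ENNReal

/-- Two-body interaction `h(x,y) = 1{xy < 0}`. -/
noncomputable def hInt (p : ℝ × ℝ) : ℝ := if p.1 * p.2 < 0 then 1 else 0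

/-- The `n`-particle Hamiltonian `H_n = (n-1)⁻¹ Σ_{i<j} h(x_i-x_j, y_i-y_j)`. -/
noncomputable def hamiltonian (n : ℕ) (z : Fin n → ℝ × ℝ) : ℝ :=
  ((n : ℝ) - 1)⁻¹ *
    ∑ i : Fin n, ∑ j : Fin n,
      if i < j then hInt ((z i).1 - (z j).1, (z i).2 - (z j).2) else 0

/-- Partition function of the Boltzmann–Gibbs measure. -/
noncomputable def gibbsZ (n : ℕ) (α : Measure (ℝ × ℝ)) (β : ℝ) : ℝ :=
  ∫ z, Real.exp (-β * hamiltonian n z) ∂(Measure.pi fun _ : Fin n => α)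

/-- The Boltzmann–Gibbs measure `μ_{n,α,β}` on `(ℝ²)ⁿ`, with density
`exp(-β Hₙ)/Z_n(α,β)` with respect to the product measure `αⁿ`. -/
noncomputable def gibbs (n : ℕ) (α : Measure (ℝ × ℝ)) (β : ℝ) : Measure (Fin n → ℝ × ℝ) :=
  (Measure.pi fun _ : Fin n => α).withDensity
    fun z => ENNReal.ofReal (Real.exp (-β * hamiltonian n z) / gibbsZ n α β)

/-- `L(β) = ((1-e^{-β})/β)^{1/2}` for `β ≠ 0`, `L(0) = 1`. -/
noncomputable def Lb (β : ℝ) : ℝ :=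
  if β = 0 then 1 else Real.sqrt ((1 - Real.exp (-β)) / β)

/-- The probability measure `λ_β` on `ℝ`, with density `L(β)/(1-βL(β)x)` on `[0,L(β)]`. -/
noncomputable def lambdaMeasure (β : ℝ) : Measure ℝ :=
  ((volume : Measure ℝ).restrict (Set.Icc 0 (Lb β))).withDensity
    fun x => ENNReal.ofReal (Lb β / (1 - β * Lb β * x))

/-- The measure `σ_β` on `ℝ²`, with density `(1-βxy)^{-2}` on `[0,L(β)]²`. -/
noncomputable def sigmaMeasure (β : ℝ) : Measure (ℝ × ℝ) :=
  ((volume : Measure (ℝ × ℝ)).restrict (Set.Icc (0, 0) (Lb β, Lb β))).withDensity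
    fun p => ENNReal.ofReal (((1 - β * p.1 * p.2) ^ 2)⁻¹)

/-- The empirical probability measure of an `n`-tuple of points in `ℝ²`
(junk value, a Dirac mass, for `n = 0`). -/
noncomputable def empiricalPts (n : ℕ) (z : Fin n → ℝ × ℝ) : ProbabilityMeasure (ℝ × ℝ) :=
  if h : n = 0 then ⟨Measure.dirac (0, 0), Measure.dirac.isProbabilityMeasure⟩
  else
    ⟨(n : ℝ≥0∞)⁻¹ • ∑ i : Fin n, Measure.dirac (z i),
      ⟨by
        have hn : (n : ℝ≥0∞) ≠ 0 := by exact_mod_cast h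
        simp [Measure.smul_apply, Measure.finset_sum_apply, smul_eq_mul,
          ENNReal.inv_mul_cancel hn (by simp)]⟩⟩

/-- The `q`-integer `[m]_q`. -/
noncomputable def qint (q : ℝ) (m : ℕ) : ℝ := ∑ i ∈ Finset.range m, q ^ i

lemma qint_zero (q : ℝ) : qint q 0 = 0 := by simp [qint]

lemma qint_succ (q : ℝ) (m : ℕ) : qint q (m + 1) = 1 + q * qint q m := by
  simp only [qint]
  rw [Finset.sum_range_succ', Finset.mul_sum]
  simp [pow_succ, mul_comm, add_comm]

lemma qint_succ' (q : ℝ) (m : ℕ) : qint q (m + 1) = qint q m + q ^ m := by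
  simp [qint, Finset.sum_range_succ]

lemma qint_nonneg {q : ℝ} (hq : 0 < q) (m : ℕ) : 0 ≤ qint q m :=
  Finset.sum_nonneg fun _ _ => by positivity

lemma qint_mono {q : ℝ} (hq : 0 < q) : Monotone (qint q) :=
  monotone_nat_of_le_succ fun m => by rw [qint_succ']; have := pow_pos hq m; linarith

lemma qint_pos {q : ℝ} (hq : 0 < q) {m : ℕ} (hm : 0 < m) : 0 < qint q m := by
  obtain ⟨m, rfl⟩ := Nat.exists_eq_succ_of_ne_zero hm.ne'
  rw [Nat.succ_eq_add_one, qint_succ]; have := qint_nonneg hq m; positivity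

/-- `q`-factorial. -/
noncomputable def qfac (q : ℝ) : ℕ → ℝ
  | 0 => 1
  | n + 1 => qint q (n + 1) * qfac q n

lemma qfac_pos {q : ℝ} (hq : 0 < q) (n : ℕ) : 0 < qfac q n := by
  induction n with
  | zero => simp [qfac]
  | succ n ih => exact mul_pos (qint_pos hq (Nat.succ_pos n)) ih

/-- inversions of a permutation -/
def pinv {n : ℕ} (π : Equiv.Perm (Fin n)) : ℕ :=
  ∑ i : Fin n, ∑ j : Fin n, if i < j ∧ π j < π i then 1 else 0

/-- number of points in the lower-left corner -/
def pN {n : ℕ} (k l : ℕ) (π : Equiv.Perm (Fin n)) : ℕ :=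
  ∑ i : Fin n, if i.val < k ∧ (π i).val < l then 1 else 0

/-- permutation with prescribed first value -/
def pcons {n : ℕ} (v : Fin (n + 1)) (π : Equiv.Perm (Fin n)) : Equiv.Perm (Fin (n + 1)) :=
  ((finSuccEquiv' 0).trans (Equiv.optionCongr π)).trans (finSuccEquiv' v).symm

lemma pcons_zero {n : ℕ} (v : Fin (n + 1)) (π : Equiv.Perm (Fin n)) : pcons v π 0 = v := by
  simp [pcons]

lemma pcons_succ {n : ℕ} (v : Fin (n + 1)) (π : Equiv.Perm (Fin n)) (i : Fin n) :
    pcons v π i.succ = v.succAbove (π i) := by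
  have : finSuccEquiv' (0 : Fin (n + 1)) i.succ = some i := by
    rw [← Fin.succAbove_zero_apply]; exact finSuccEquiv'_succAbove 0 i
  simp [pcons, this]

lemma pcons_bij (n : ℕ) :
    Function.Bijective (fun p : Fin (n + 1) × Equiv.Perm (Fin n) => pcons p.1 p.2) := by
  rw [Fintype.bijective_iff_injective_and_card]
  constructor
  · rintro ⟨v, π⟩ ⟨w, ρ⟩ h
    simp only at h
    have h0 : v = w := by rw [← pcons_zero v π, ← pcons_zero w ρ, h]
    subst h0
    have : π = ρ := by
      ext i
      have := pcons_succ v π i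
      rw [h, pcons_succ] at this
      rw [Fin.succAbove_right_injective this]
    rw [this]
  · simp [Fintype.card_perm, Nat.factorial_succ]

lemma card_below {n : ℕ} (v : Fin (n + 1)) (π : Equiv.Perm (Fin n)) :
    (∑ j : Fin n, if v.succAbove (π j) < v then 1 else 0) = v.val := by
  rw [Equiv.sum_comp π (fun j => if v.succAbove j < v then 1 else 0)]
  have h : ∀ j : Fin n, v.succAbove j < v ↔ j.val < v.val := by
    intro j
    rw [Fin.succAbove_lt_iff_castSucc_lt]; rfl
  simp only [h]
  rw [Fin.sum_univ_eq_sum_range (fun j => if j < v.val then 1 else 0) n]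
  rw [← Finset.sum_filter, Finset.sum_const, smul_eq_mul, mul_one]
  have : (Finset.range n).filter (fun j => j < v.val) = Finset.range v.val := by
    ext j; simp; omega
  rw [this, Finset.card_range]

lemma pinv_pcons {n : ℕ} (v : Fin (n + 1)) (π : Equiv.Perm (Fin n)) :
    pinv (pcons v π) = v.val + pinv π := by
  unfold pinv
  rw [Fin.sum_univ_succ]
  congr 1
  · rw [Fin.sum_univ_succ]
    simp only [pcons_zero, pcons_succ, lt_irrefl, false_and, if_false, Fin.succ_pos, true_and,
      zero_add]
    exact card_below v π
  · refine Finset.sum_congr rfl fun i _ => ?_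
    rw [Fin.sum_univ_succ]
    simp [pcons_zero, pcons_succ, Fin.succAbove_lt_succAbove_iff]

lemma pN_pcons {n : ℕ} (k l : ℕ) (v : Fin (n + 1)) (π : Equiv.Perm (Fin n)) :
    pN (k + 1) l (pcons v π) = if v.val < l then pN k (l - 1) π + 1 else pN k l π := by
  unfold pN
  rw [Fin.sum_univ_succ]
  simp only [pcons_zero, pcons_succ, Fin.val_succ, Fin.val_zero, Nat.zero_lt_succ, true_and,
    Nat.add_lt_add_iff_right]
  have hs : ∀ w : Fin n, (v.succAbove w).val = if w.val < v.val then w.val else w.val + 1 := by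
    intro w
    simp only [Fin.succAbove, Fin.lt_def, Fin.val_castSucc]
    split_ifs <;> rfl
  simp only [hs]
  by_cases h : v.val < l
  · simp only [h, if_true]
    rw [add_comm]
    congr 1
    refine Finset.sum_congr rfl fun i _ => ?_
    congr 1
    apply propext
    refine and_congr_right fun _ => ?_
    split_ifs <;> omega
  · simp only [h, if_false, zero_add]
    refine Finset.sum_congr rfl fun i _ => ?_
    congr 1
    apply propext
    refine and_congr_right fun _ => ?_
    split_ifs <;> omega

/-- weighted sums over permutations -/
noncomputable def pS (q : ℝ) (n k l : ℕ) (f : ℕ → ℝ) : ℝ :=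
  ∑ π : Equiv.Perm (Fin n), q ^ pinv π * f (pN k l π)

lemma pS_add (q : ℝ) (n k l : ℕ) (f g : ℕ → ℝ) :
    pS q n k l (fun m => f m + g m) = pS q n k l f + pS q n k l g := by
  simp [pS, mul_add, Finset.sum_add_distrib]

lemma pS_smul (q : ℝ) (n k l : ℕ) (c : ℝ) (f : ℕ → ℝ) :
    pS q n k l (fun m => c * f m) = c * pS q n k l f := by
  simp only [pS, Finset.mul_sum]
  refine Finset.sum_congr rfl fun _ _ => by ring

lemma pS_congr (q : ℝ) (n k l : ℕ) {f g : ℕ → ℝ} (h : ∀ m, f m = g m) :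
    pS q n k l f = pS q n k l g := by
  simp [pS, h]

lemma sum_pow_fin (q : ℝ) {n l : ℕ} (hl : l ≤ n) (A B : ℝ) :
    (∑ v : Fin n, q ^ v.val * (if v.val < l then A else B))
      = qint q l * A + (qint q n - qint q l) * B := by
  rw [Fin.sum_univ_eq_sum_range (fun v => q ^ v * (if v < l then A else B)) n]
  obtain ⟨d, rfl⟩ := Nat.exists_eq_add_of_le hl
  have e : qint q (l + d) - qint q l = ∑ i ∈ Finset.range d, q ^ (l + i) := by
    simp [qint, Finset.sum_range_add]
  rw [Finset.sum_range_add, e, Finset.sum_mul, qint, Finset.sum_mul]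
  congr 1
  · refine Finset.sum_congr rfl fun i hi => ?_
    rw [if_pos (Finset.mem_range.1 hi)]
  · refine Finset.sum_congr rfl fun i hi => ?_
    rw [if_neg (by omega)]

lemma pS_rec (q : ℝ) (n k l : ℕ) (hl : l ≤ n + 1) (f : ℕ → ℝ) :
    pS q (n + 1) (k + 1) l f
      = qint q l * pS q n k (l - 1) (fun m => f (m + 1))
        + (qint q (n + 1) - qint q l) * pS q n k l f := by
  rw [← sum_pow_fin q hl]
  unfold pS
  rw [← (pcons_bij n).sum_comp (fun π => q ^ pinv π * f (pN (k + 1) l π)), Fintype.sum_prod_type]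
  refine Finset.sum_congr rfl fun v _ => ?_
  split_ifs with h
  all_goals
    rw [Finset.mul_sum]
    refine Finset.sum_congr rfl fun π _ => ?_
    simp only [pinv_pcons, pN_pcons, h, if_true, if_false, pow_add]
    ring

lemma pN_zero {n : ℕ} (l : ℕ) (π : Equiv.Perm (Fin n)) : pN 0 l π = 0 := by
  simp [pN]

lemma pS_one (q : ℝ) (n k l : ℕ) : pS q n k l (fun _ => 1) = qfac q n := by
  induction n generalizing k l with
  | zero => simp [pS, qfac, pinv]
  | succ n ih =>
    have h : pS q (n + 1) k l (fun _ => 1) = pS q (n + 1) 1 0 (fun _ => 1) := by simp [pS]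
    rw [h, pS_rec q n 0 0 (by omega), ih, qint_zero, qfac]; ring

lemma pS_first {q : ℝ} (hq : 0 < q) (n k l : ℕ) (hk : k ≤ n) (hl : l ≤ n) :
    qint q n * pS q n k l (qint q) = qint q k * qint q l * qfac q n := by
  induction n generalizing k l with
  | zero => simp [qint_zero, Nat.le_zero.1 hk]
  | succ n ih =>
    rcases k with _ | k
    · simp [pS, pN_zero, qint_zero]
    have hk' : k ≤ n := by omega
    rw [pS_rec q n k l hl, pS_congr q n k (l - 1) (fun m => qint_succ q m), pS_add, pS_one, pS_smul,
      qfac]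
    rcases Nat.eq_zero_or_pos n with rfl | hn
    · have : pS q 0 k l (qint q) = 0 := by simp [pS, pN, qint_zero]
      have h' : pS q 0 k (l - 1) (qint q) = 0 := by simp [pS, pN, qint_zero]
      have hk0 : k = 0 := by omega
      rw [this, h', hk0]
      simp [qfac, qint_succ, qint_zero]
    have hn' := qint_pos hq hn
    rcases l with _ | l
    · have := ih k 0 hk' (by omega)
      rw [qint_zero] at this ⊢
      have h0 : pS q n k 0 (qint q) = 0 := by
        have : qint q n * pS q n k 0 (qint q) = 0 := by linarith
        rcases mul_eq_zero.1 this with h | h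
        · exact absurd h hn'.ne'
        · exact h
      rw [h0]; ring
    have h1 := ih k l hk' (by omega)
    simp only [Nat.add_sub_cancel]
    rcases Nat.lt_or_ge n (l + 1) with h | h
    · have : l = n := by omega
      subst this
      rw [sub_self]
      have h2 := qint_succ q k
      have h3 := qint_succ q l
      apply mul_left_cancel₀ hn'.ne'
      rw [h2]
      linear_combination (q * qint q (l+1) * qint q (l+1)) * h1
    · have h4 := ih k (l + 1) hk' h
      have h2 := qint_succ q k
      have h3 := qint_succ q l
      have h5 := qint_succ q n
      apply mul_left_cancel₀ hn'.ne'
      rw [h2]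
      have e1 : qint q (n+1) * (qint q (l+1) * (qfac q n + q * pS q n k l (qint q)) + (qint q (n+1) - qint q (l+1)) * pS q n k (l+1) (qint q)) * qint q n = qint q (n+1) * (qint q (l+1) * (qint q n * qfac q n + q * (qint q k * qint q l * qfac q n)) + (qint q (n+1) - qint q (l+1)) * (qint q k * qint q (l+1) * qfac q n)) := by
        rw [← h1, ← h4]; ring
      rw [mul_comm, e1, h3, h5]; ring

lemma pS_second {q : ℝ} (hq : 0 < q) (n k l : ℕ) (hk : k ≤ n) (hl : l ≤ n) :
    qint q n * qint q (n - 1) * pS q n k l (fun m => qint q m * qint q (m - 1))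
      = qint q k * qint q (k - 1) * (qint q l * qint q (l - 1)) * qfac q n := by
  induction n generalizing k l with
  | zero => simp [qint_zero, Nat.le_zero.1 hk]
  | succ n ih =>
    rcases k with _ | k
    · simp [pS, pN_zero, qint_zero]
    have hk' : k ≤ n := by omega
    have hf : ∀ m, qint q (m + 1) * qint q (m + 1 - 1)
        = (1 + q) * qint q m + q ^ 2 * (qint q m * qint q (m - 1)) := by
      intro m
      rcases m with _ | m
      · simp [qint_zero]
      · simp only [Nat.add_sub_cancel]
        rw [qint_succ q (m + 1), qint_succ q m]; ring
    rw [pS_rec q n k l hl, pS_congr q n k (l - 1) hf, pS_add, pS_smul, pS_smul, qfac]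
    simp only [Nat.add_sub_cancel]
    rcases Nat.eq_zero_or_pos n with rfl | hn
    · have hk0 : k = 0 := by omega
      simp [hk0, qint_zero]
    have hn' := qint_pos hq hn
    obtain ⟨n, rfl⟩ := Nat.exists_eq_succ_of_ne_zero hn.ne'
    simp only [Nat.succ_eq_add_one, Nat.add_sub_cancel] at *
    rcases Nat.eq_zero_or_pos n with rfl | hn2
    · -- two points
      have z : ∀ k l, pS q 1 k l (fun m => qint q m * qint q (m - 1)) = 0 := by
        intro k l
        unfold pS
        refine Finset.sum_eq_zero fun π _ => ?_
        have : pN k l π = 0 ∨ pN k l π = 1 := by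
          simp only [pN, Fin.sum_univ_one]; split_ifs <;> simp
        rcases this with h | h <;> simp [h, qint_zero]
      simp only [z]
      have h1 : qint q 1 = 1 := by simp [qint]
      have hb := pS_first hq 1 k (l - 1) (by omega) (by omega)
      simp only [qfac, zero_add, h1, one_mul, mul_one] at hb ⊢
      rw [hb]
      rcases k with _ | k
      · simp [qint_zero]
      have : k = 0 := by omega
      subst this
      simp [h1, qint_succ]; ring
    have hn2' := qint_pos hq hn2
    have hb := pS_first hq (n + 1) k (l - 1) (by omega) (by omega)
    have hc := ih k (l - 1) (by omega) (by omega)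
    set B := pS q (n + 1) k (l - 1) (qint q)
    set C := pS q (n + 1) k (l - 1) (fun m => qint q m * qint q (m - 1))
    apply mul_left_cancel₀ hn2'.ne'
    have key : qint q (n+1) * qint q n * ((qint q (n+1+1) - qint q l) * pS q (n + 1) k l (fun m => qint q m * qint q (m - 1)))
        = (qint q (n+1+1) - qint q l) * (qint q k * qint q (k - 1) * (qint q l * qint q (l - 1)) * qfac q (n+1)) := by
      rcases Nat.lt_or_ge (n + 1) l with h | h
      · have : l = n + 1 + 1 := by omega
        rw [this]; ring
      · rw [← ih k l (by omega) h]; ring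
    have e : qint q n * (qint q (n+1+1) * qint q (n+1) * (qint q l * ((1+q) * B + q^2 * C) + (qint q (n+1+1) - qint q l) * pS q (n + 1) k l (fun m => qint q m * qint q (m - 1))))
       = qint q (n+1+1) * (qint q l * ((1+q) * qint q n * (qint q k * qint q (l-1) * qfac q (n+1)) + q^2 * (qint q k * qint q (k - 1) * (qint q (l-1) * qint q (l - 1 - 1)) * qfac q (n+1))) + (qint q (n+1+1) - qint q l) * (qint q k * qint q (k - 1) * (qint q l * qint q (l - 1)) * qfac q (n+1))) := by
      rw [← key, ← hb, ← hc]; ring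
    rw [e]
    have hn3 : qint q (n + 1 + 1) = 1 + q + q ^ 2 * qint q n := by
      rw [qint_succ, qint_succ]; ring
    rcases l with _ | _ | l
    · simp [qint_zero]
    · simp [qint_zero]
    simp only [Nat.add_sub_cancel]
    rcases k with _ | k
    · simp [qint_zero]
    simp only [Nat.add_sub_cancel]
    have hl3 : qint q (l + 1 + 1) = 1 + q + q ^ 2 * qint q l := by
      rw [qint_succ, qint_succ]; ring
    have hk3 : qint q (k + 1 + 1) = 1 + q + q ^ 2 * qint q k := by
      rw [qint_succ, qint_succ]; ring
    rw [hn3, hl3, hk3]; ring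

/-- number of inversions of a configuration -/
noncomputable def zinv {n : ℕ} (z : Fin n → ℝ × ℝ) : ℕ :=
  ∑ i : Fin n, ∑ j : Fin n, if (z i).1 < (z j).1 ∧ (z j).2 < (z i).2 then 1 else 0

/-- number of points with `x ≤ a` -/
noncomputable def cX {n : ℕ} (a : ℝ) (z : Fin n → ℝ × ℝ) : ℕ :=
  ∑ i : Fin n, if (z i).1 ≤ a then 1 else 0

/-- number of points with `y ≤ b` -/
noncomputable def cY {n : ℕ} (b : ℝ) (z : Fin n → ℝ × ℝ) : ℕ :=
  ∑ i : Fin n, if (z i).2 ≤ b then 1 else 0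

/-- number of points with `x ≤ a` and `y ≤ b` -/
noncomputable def cN {n : ℕ} (a b : ℝ) (z : Fin n → ℝ × ℝ) : ℕ :=
  ∑ i : Fin n, if (z i).1 ≤ a ∧ (z i).2 ≤ b then 1 else 0

/-- permute the second coordinates -/
def permY {n : ℕ} (π : Equiv.Perm (Fin n)) (z : Fin n → ℝ × ℝ) : Fin n → ℝ × ℝ :=
  fun i => ((z i).1, (z (π i)).2)

lemma sum_ite_le {n : ℕ} (p : Fin n → Prop) [DecidablePred p] :
    (∑ i : Fin n, if p i then 1 else 0) ≤ n := by
  calc (∑ i : Fin n, if p i then 1 else 0) ≤ ∑ i : Fin n, 1 :=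
        Finset.sum_le_sum fun i _ => by split_ifs <;> simp
    _ = n := by simp

lemma cX_le {n : ℕ} (a : ℝ) (z : Fin n → ℝ × ℝ) : cX a z ≤ n := sum_ite_le _
lemma cY_le {n : ℕ} (a : ℝ) (z : Fin n → ℝ × ℝ) : cY a z ≤ n := sum_ite_le _
lemma cN_le {n : ℕ} (a b : ℝ) (z : Fin n → ℝ × ℝ) : cN a b z ≤ n := sum_ite_le _

lemma cX_permY {n : ℕ} (a : ℝ) (π : Equiv.Perm (Fin n)) (z : Fin n → ℝ × ℝ) :
    cX a (permY π z) = cX a z := rfl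

lemma cY_permY {n : ℕ} (a : ℝ) (π : Equiv.Perm (Fin n)) (z : Fin n → ℝ × ℝ) :
    cY a (permY π z) = cY a z :=
  Equiv.sum_comp π (fun i => if (z i).2 ≤ a then 1 else 0)

lemma hInt_sub (p r : ℝ × ℝ) : hInt (p.1 - r.1, p.2 - r.2)
    = ((if p.1 < r.1 ∧ r.2 < p.2 then 1 else 0 : ℕ) : ℝ)
      + ((if r.1 < p.1 ∧ p.2 < r.2 then 1 else 0 : ℕ) : ℝ) := by
  unfold hInt
  simp only [mul_neg_iff, sub_pos, sub_neg]
  by_cases h1 : p.1 < r.1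
  · have h2 : ¬ r.1 < p.1 := by linarith
    simp [h1, h2]
  · by_cases h2 : r.1 < p.1
    · simp [h1, h2]
    · simp [h1, h2]

lemma ham_sum {n : ℕ} (z : Fin n → ℝ × ℝ) :
    (∑ i : Fin n, ∑ j : Fin n,
      if i < j then hInt ((z i).1 - (z j).1, (z i).2 - (z j).2) else 0) = (zinv z : ℝ) := by
  set A : Fin n → Fin n → ℝ := fun i j =>
    ((if (z i).1 < (z j).1 ∧ (z j).2 < (z i).2 then 1 else 0 : ℕ) : ℝ) with hA
  have hz : (zinv z : ℝ) = ∑ i, ∑ j, A i j := by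
    simp only [zinv, hA]; push_cast; rfl
  have hd : ∀ i, A i i = 0 := fun i => by simp [hA]
  have h1 : ∀ i j, A i j = (if i < j then A i j else 0) + (if j < i then A i j else 0) := by
    intro i j
    rcases lt_trichotomy i j with h | h | h
    · simp [h, h.not_gt]
    · subst h; simp [hd]
    · simp [h, h.not_gt]
  rw [hz]
  have h2 : (∑ i, ∑ j, A i j) = (∑ i, ∑ j, if i < j then A i j else 0)
      + ∑ i, ∑ j, if j < i then A i j else 0 := by
    rw [← Finset.sum_add_distrib]
    refine Finset.sum_congr rfl fun i _ => ?_
    rw [← Finset.sum_add_distrib]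
    exact Finset.sum_congr rfl fun j _ => h1 i j
  rw [h2, Finset.sum_comm (f := fun i j => if j < i then A i j else 0), ← Finset.sum_add_distrib]
  refine Finset.sum_congr rfl fun i _ => ?_
  rw [← Finset.sum_add_distrib]
  refine Finset.sum_congr rfl fun j _ => ?_
  by_cases h : i < j
  · rw [if_pos h, if_pos h, if_pos h, hInt_sub]
  · rw [if_neg h, if_neg h, if_neg h, add_zero]

lemma hamiltonian_eq (n : ℕ) (z : Fin n → ℝ × ℝ) :
    hamiltonian n z = ((n : ℝ) - 1)⁻¹ * (zinv z : ℝ) := by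
  rw [hamiltonian, ham_sum]

lemma exp_ham (n : ℕ) (β : ℝ) (z : Fin n → ℝ × ℝ) :
    Real.exp (-β * hamiltonian n z) = (Real.exp (-β * ((n : ℝ) - 1)⁻¹)) ^ (zinv z) := by
  rw [hamiltonian_eq, ← Real.exp_nat_mul]; congr 1; ring

lemma sort_data {n : ℕ} (x : Fin n → ℝ) (hx : Function.Injective x) :
    ∃ σ : Equiv.Perm (Fin n), StrictMono (x ∘ σ) ∧
      ∀ a : ℝ, ∀ i, (x (σ i) ≤ a ↔ i.val < ∑ i : Fin n, if x i ≤ a then 1 else 0) := by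
  refine ⟨Tuple.sort x, (Tuple.monotone_sort x).strictMono_of_injective
    (hx.comp (Tuple.sort x).injective), fun a i => ?_⟩
  have h := Tuple.lt_card_le_iff_apply_le_of_monotone (a := a) (j := i) (Tuple.monotone_sort x)
  rw [← Equiv.sum_comp (Tuple.sort x) (fun i => if x i ≤ a then 1 else 0)]
  rw [← Finset.sum_filter, Finset.sum_const, smul_eq_mul, mul_one]
  exact h.symm

lemma reindex {n : ℕ} (z : Fin n → ℝ × ℝ) (h1 : Function.Injective fun i => (z i).1)
    (h2 : Function.Injective fun i => (z i).2) :
    ∃ ρ : Equiv.Perm (Fin n) ≃ Equiv.Perm (Fin n), ∀ π,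
      zinv (permY π z) = pinv (ρ π) ∧
      ∀ a b, cN a b (permY π z) = pN (cX a z) (cY b z) (ρ π) := by
  obtain ⟨σ, hσ, hσ'⟩ := sort_data _ h1
  obtain ⟨τ, hτ, hτ'⟩ := sort_data _ h2
  refine ⟨(Equiv.mulRight σ).trans (Equiv.mulLeft τ⁻¹), fun π => ?_⟩
  have e : ∀ i, π (σ i) = τ (((Equiv.mulRight σ).trans (Equiv.mulLeft τ⁻¹)) π i) := by
    intro i; simp
  set ρ := ((Equiv.mulRight σ).trans (Equiv.mulLeft τ⁻¹)) π
  constructor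
  · unfold zinv pinv
    rw [← Equiv.sum_comp σ]
    refine Finset.sum_congr rfl fun i _ => ?_
    rw [← Equiv.sum_comp σ]
    refine Finset.sum_congr rfl fun j _ => ?_
    simp only [permY, e]
    have a1 := hσ.lt_iff_lt (a := i) (b := j)
    have a2 := hτ.lt_iff_lt (a := ρ j) (b := ρ i)
    simp only [Function.comp] at a1 a2
    simp only [a1, a2]
  · intro a b
    unfold cN pN
    rw [← Equiv.sum_comp σ]
    refine Finset.sum_congr rfl fun i _ => ?_
    simp only [permY, e]
    have a1 : (z (σ i)).1 ≤ a ↔ i.val < cX a z := hσ' a i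
    have a2 : (z (τ (ρ i))).2 ≤ b ↔ (ρ i).val < cY b z := hτ' b (ρ i)
    simp only [a1, a2]

lemma sum_perm {n : ℕ} (q : ℝ) (z : Fin n → ℝ × ℝ) (h1 : Function.Injective fun i => (z i).1)
    (h2 : Function.Injective fun i => (z i).2) (a b : ℝ) (f : ℕ → ℝ) :
    (∑ π : Equiv.Perm (Fin n), q ^ zinv (permY π z) * f (cN a b (permY π z)))
      = pS q n (cX a z) (cY b z) f := by
  obtain ⟨ρ, hρ⟩ := reindex z h1 h2
  unfold pS
  rw [← Equiv.sum_comp ρ (fun π => q ^ pinv π * f (pN (cX a z) (cY b z) π))]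
  refine Finset.sum_congr rfl fun π _ => ?_
  rw [(hρ π).1, (hρ π).2]

/-- The fluctuation variable. -/
noncomputable def Dv (q : ℝ) {n : ℕ} (a b : ℝ) (z : Fin n → ℝ × ℝ) : ℝ :=
  qint q (cN a b z) - qint q (cX a z) * qint q (cY b z) / qint q n

lemma qint_le {q Q : ℝ} {n : ℕ} (hQ : ∀ i < n, q ^ i ≤ Q) : qint q n ≤ n * Q := by
  unfold qint
  calc (∑ i ∈ Finset.range n, q ^ i) ≤ ∑ i ∈ Finset.range n, Q :=
        Finset.sum_le_sum fun i hi => hQ i (Finset.mem_range.1 hi)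
    _ = n * Q := by simp

lemma pS_mono {q : ℝ} (hq : 0 < q) {n k l : ℕ} {f g : ℕ → ℝ} (h : ∀ m ≤ n, f m ≤ g m) :
    pS q n k l f ≤ pS q n k l g :=
  Finset.sum_le_sum fun π _ => mul_le_mul_of_nonneg_left (h _ (sum_ite_le _)) (by positivity)

lemma pS_var {q Q : ℝ} (hq : 0 < q) {n k l : ℕ} (hn : 2 ≤ n) (hQ : ∀ i < n, q ^ i ≤ Q)
    (hk : k ≤ n) (hl : l ≤ n) :
    pS q n k l (fun m => (qint q m - qint q k * qint q l / qint q n) ^ 2)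
      ≤ n * Q ^ 2 * qfac q n := by
  have hQ0 : 0 ≤ Q := by have := hQ 0 (by omega); simp at this; linarith
  set c := qint q k * qint q l / qint q n with hc
  have hF := qfac_pos hq n
  have hn0 := qint_pos hq (show 0 < n by omega)
  have hn1 := qint_pos hq (show 0 < n - 1 by omega)
  have f1 := pS_first hq n k l hk hl
  have f2 := pS_second hq n k l hk hl
  have hB : pS q n k l (qint q) = c * qfac q n := by
    rw [hc]; field_simp; linarith
  have hk0 := qint_nonneg hq k
  have hl0 := qint_nonneg hq l
  have hc0 : 0 ≤ c := by positivity
  have hkn := qint_mono hq hk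
  have hln := qint_mono hq hl
  have hC : pS q n k l (fun m => qint q m * qint q (m - 1)) ≤ c ^ 2 * qfac q n := by
    have e1 : qint q n * qint q (k - 1) ≤ qint q k * qint q (n - 1) := by
      rcases k with _ | k
      · simp [qint_zero]
      obtain ⟨n, rfl⟩ : ∃ m, n = m + 1 := ⟨n - 1, by omega⟩
      simp only [Nat.add_sub_cancel]
      rw [qint_succ, qint_succ]
      have := qint_mono hq (show k ≤ n by omega)
      linarith
    have e2 : qint q (l - 1) ≤ qint q l := qint_mono hq (by omega)
    have e3 : qint q k * qint q (k - 1) * (qint q l * qint q (l - 1)) * qint q n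
        ≤ qint q k ^ 2 * qint q l ^ 2 * qint q (n - 1) := by
      calc _ = (qint q k * qint q l) * ((qint q n * qint q (k - 1)) * qint q (l - 1)) := by ring
        _ ≤ (qint q k * qint q l) * ((qint q k * qint q (n - 1)) * qint q l) := by
            apply mul_le_mul_of_nonneg_left _ (by positivity)
            exact mul_le_mul e1 e2 (qint_nonneg hq _) (by positivity)
        _ = _ := by ring
    have e4 : pS q n k l (fun m => qint q m * qint q (m - 1)) =
        qint q k * qint q (k - 1) * (qint q l * qint q (l - 1)) * qfac q n /
          (qint q n * qint q (n - 1)) := by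
      rw [eq_div_iff (by positivity), ← f2]; ring
    rw [e4, hc, div_le_iff₀ (by positivity)]
    have : (qint q k * qint q l / qint q n) ^ 2 * qfac q n * (qint q n * qint q (n - 1))
        = (qint q k ^ 2 * qint q l ^ 2 * qint q (n - 1)) * qfac q n / qint q n := by
      field_simp
    rw [this, le_div_iff₀ hn0]
    calc _ = (qint q k * qint q (k - 1) * (qint q l * qint q (l - 1)) * qint q n) * qfac q n := by
          ring
      _ ≤ _ := mul_le_mul_of_nonneg_right e3 hF.le
  have hpt : ∀ m ≤ n, (qint q m - c) ^ 2
      ≤ qint q m * qint q (m - 1) + ((Q - 2 * c) * qint q m + c ^ 2 * 1) := by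
    intro m hm
    rcases m with _ | m
    · simp [qint_zero]
    · have h1 := qint_succ' q m
      have h2 := hQ m (by omega)
      have h3 := qint_nonneg hq (m + 1)
      simp only [Nat.add_sub_cancel]
      have h4 : qint q (m + 1) * q ^ m ≤ qint q (m + 1) * Q := mul_le_mul_of_nonneg_left h2 h3
      have h5 : qint q m = qint q (m + 1) - q ^ m := by linarith
      rw [h5]; nlinarith
  have hcn : c ≤ n * Q := by
    have : c ≤ qint q n := by
      rw [hc, div_le_iff₀ hn0]; exact mul_le_mul hkn hln hl0 hn0.le
    exact this.trans (qint_le hQ)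
  calc _ ≤ _ := pS_mono hq hpt
    _ = pS q n k l (fun m => qint q m * qint q (m - 1)) + ((Q - 2 * c) * pS q n k l (qint q)
        + c ^ 2 * qfac q n) := by
      rw [pS_add, pS_add, pS_smul, pS_smul, pS_one]
    _ ≤ c ^ 2 * qfac q n + ((Q - 2 * c) * (c * qfac q n) + c ^ 2 * qfac q n) := by
      rw [hB]; gcongr
    _ = Q * c * qfac q n := by ring
    _ ≤ Q * (n * Q) * qfac q n := by gcongr
    _ = _ := by ring

lemma sum_perm_one {n : ℕ} (q : ℝ) (z : Fin n → ℝ × ℝ) (h1 : Function.Injective fun i => (z i).1)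
    (h2 : Function.Injective fun i => (z i).2) :
    (∑ π : Equiv.Perm (Fin n), q ^ zinv (permY π z)) = qfac q n := by
  have := sum_perm q z h1 h2 0 0 (fun _ => 1)
  rw [pS_one] at this
  simpa using this

lemma sum_perm_D {q Q : ℝ} (hq : 0 < q) {n : ℕ} (hn : 2 ≤ n) (hQ : ∀ i < n, q ^ i ≤ Q)
    (z : Fin n → ℝ × ℝ) (h1 : Function.Injective fun i => (z i).1)
    (h2 : Function.Injective fun i => (z i).2) (a b : ℝ) :
    (∑ π : Equiv.Perm (Fin n), q ^ zinv (permY π z) * Dv q a b (permY π z) ^ 2)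
      ≤ n * Q ^ 2 * qfac q n := by
  simp only [Dv, cX_permY, cY_permY]
  rw [sum_perm q z h1 h2 a b
    (fun m => (qint q m - qint q (cX a z) * qint q (cY b z) / qint q n) ^ 2)]
  exact pS_var hq hn hQ (cX_le _ _) (cY_le _ _)

lemma measurable_zinv {n : ℕ} : Measurable (zinv : (Fin n → ℝ × ℝ) → ℕ) := by
  unfold zinv
  refine Finset.measurable_sum _ fun i _ => Finset.measurable_sum _ fun j _ => ?_
  refine Measurable.ite ?_ measurable_const measurable_const
  exact MeasurableSet.inter (measurableSet_lt (f := fun z : Fin n → ℝ × ℝ => (z i).1)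
    (g := fun z : Fin n → ℝ × ℝ => (z j).1) (by fun_prop) (by fun_prop))
    (measurableSet_lt (f := fun z : Fin n → ℝ × ℝ => (z j).2)
    (g := fun z : Fin n → ℝ × ℝ => (z i).2) (by fun_prop) (by fun_prop))

lemma measurable_cX {n : ℕ} (a : ℝ) : Measurable (cX a : (Fin n → ℝ × ℝ) → ℕ) := by
  unfold cX
  refine Finset.measurable_sum _ fun i _ => ?_
  exact Measurable.ite (measurableSet_le (by fun_prop) (by fun_prop)) measurable_const
    measurable_const

lemma measurable_cY {n : ℕ} (a : ℝ) : Measurable (cY a : (Fin n → ℝ × ℝ) → ℕ) := by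
  unfold cY
  refine Finset.measurable_sum _ fun i _ => ?_
  exact Measurable.ite (measurableSet_le (by fun_prop) (by fun_prop)) measurable_const
    measurable_const

lemma measurable_cN {n : ℕ} (a b : ℝ) : Measurable (cN a b : (Fin n → ℝ × ℝ) → ℕ) := by
  unfold cN
  refine Finset.measurable_sum _ fun i _ => ?_
  refine Measurable.ite ?_ measurable_const measurable_const
  exact MeasurableSet.inter (measurableSet_le (f := fun z : Fin n → ℝ × ℝ => (z i).1)
    (g := fun _ => a) (by fun_prop) (by fun_prop))
    (measurableSet_le (f := fun z : Fin n → ℝ × ℝ => (z i).2)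
    (g := fun _ => b) (by fun_prop) (by fun_prop))

lemma measurable_qint {X : Type*} [MeasurableSpace X] (q : ℝ) {f : X → ℕ} (hf : Measurable f) :
    Measurable fun x => qint q (f x) :=
  (measurable_from_nat (f := qint q)).comp hf

lemma measurable_Dv {n : ℕ} (q a b : ℝ) : Measurable (Dv q a b : (Fin n → ℝ × ℝ) → ℝ) := by
  unfold Dv
  have h1 := measurable_qint q (measurable_cN (n := n) a b)
  have h2 := measurable_qint q (measurable_cX (n := n) a)
  have h3 := measurable_qint q (measurable_cY (n := n) b)
  fun_prop

lemma measurable_permY {n : ℕ} (π : Equiv.Perm (Fin n)) : Measurable (permY π) := by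
  unfold permY
  fun_prop

lemma zinv_le {n : ℕ} (z : Fin n → ℝ × ℝ) : zinv z ≤ n * n := by
  unfold zinv
  calc _ ≤ ∑ i : Fin n, n := Finset.sum_le_sum fun i _ => sum_ite_le _
    _ = n * n := by simp

section
variable (ν : Measure ℝ) [IsProbabilityMeasure ν]

lemma permY_mp {n : ℕ} (π : Equiv.Perm (Fin n)) :
    MeasurePreserving (permY π) (Measure.pi fun _ : Fin n => ν.prod ν)
      (Measure.pi fun _ : Fin n => ν.prod ν) := by
  have h1 := measurePreserving_arrowProdEquivProdArrow ℝ ℝ (Fin n) (fun _ => ν) (fun _ => ν)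
  have h2 : MeasurePreserving (fun (y : Fin n → ℝ) i => y (π i)) (Measure.pi fun _ => ν)
      (Measure.pi fun _ => ν) := by
    have := measurePreserving_piCongrLeft (fun _ : Fin n => ν) π.symm
    convert this using 1
    ext y i
    have := MeasurableEquiv.piCongrLeft_apply_apply (β := fun _ : Fin n => ℝ) π.symm y (π i)
    simpa using this.symm
  have h3 := (MeasurePreserving.id (Measure.pi fun _ : Fin n => ν)).prod h2
  have h4 := h1.symm.comp (h3.comp h1)
  exact h4

lemma ae_inj [NullSingletonClass ν] (n : ℕ) : ∀ᵐ z ∂(Measure.pi fun _ : Fin n => ν.prod ν),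
    (Function.Injective fun i => (z i).1) ∧ (Function.Injective fun i => (z i).2) := by
  have key : ∀ (g : ℝ × ℝ → ℝ), Measurable g → Measure.map g (ν.prod ν) = ν →
      ∀ᵐ z ∂(Measure.pi fun _ : Fin n => ν.prod ν), Function.Injective fun i => g (z i) := by
    intro g hg hm
    have : ∀ i j : Fin n, i ≠ j →
        ∀ᵐ z ∂(Measure.pi fun _ : Fin n => ν.prod ν), g (z i) ≠ g (z j) := by
      intro i j hij
      have hI := (ProbabilityTheory.iIndepFun_pi (μ := fun _ : Fin n => ν.prod ν)
        (X := fun _ => g) (fun _ => hg.aemeasurable)).indepFun hij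
      have mi : ∀ i : Fin n, Measurable fun z : Fin n → ℝ × ℝ => g (z i) := fun i => by fun_prop
      have hmi : ∀ i : Fin n, Measure.map (fun z : Fin n → ℝ × ℝ => g (z i))
          (Measure.pi fun _ : Fin n => ν.prod ν) = ν := by
        intro i
        have := (measurePreserving_eval (fun _ : Fin n => ν.prod ν) i).map_eq
        have h3 := Measure.map_map (μ := Measure.pi fun _ : Fin n => ν.prod ν) hg
          (measurable_pi_apply i)
        have h4 : Measure.map (fun z : Fin n → ℝ × ℝ => z i)
            (Measure.pi fun _ : Fin n => ν.prod ν) = ν.prod ν := this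
        rw [h4, hm] at h3
        exact h3.symm
      rw [ProbabilityTheory.indepFun_iff_map_prod_eq_prod_map_map (mi i).aemeasurable
        (mi j).aemeasurable, hmi, hmi] at hI
      have hD : MeasurableSet {p : ℝ × ℝ | p.1 ≠ p.2} :=
        (measurableSet_eq_fun measurable_fst measurable_snd).compl
      have h0 : ∀ᵐ p ∂(ν.prod ν), p.1 ≠ p.2 := by
        rw [Measure.ae_prod_iff_ae_ae hD]
        refine Eventually.of_forall fun x => ?_
        rw [ae_iff]
        have : {y | ¬ (x, y).1 ≠ (x, y).2} = {x} := by ext y; simp [eq_comm]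
        rw [this]; simp
      rw [← hI] at h0
      exact ae_of_ae_map (((mi i).prodMk (mi j)).aemeasurable) h0
    have h2 : ∀ᵐ z ∂(Measure.pi fun _ : Fin n => ν.prod ν), ∀ i j : Fin n, i ≠ j →
        g (z i) ≠ g (z j) := by
      rw [ae_all_iff]; intro i; rw [ae_all_iff]; intro j
      by_cases h : i = j
      · simp [h]
      · filter_upwards [this i j h] with z hz _ using hz
    filter_upwards [h2] with z hz i j hij
    by_contra h
    exact hz i j h hij
  filter_upwards [key Prod.fst measurable_fst (by simp [Measure.map_fst_prod]),
    key Prod.snd measurable_snd (by simp [Measure.map_snd_prod])] with z h1 h2 using ⟨h1, h2⟩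

lemma integrable_w {n : ℕ} {q : ℝ} (hq : 0 < q) {G : (Fin n → ℝ × ℝ) → ℝ} (hG : Measurable G)
    {M : ℝ} (hM : ∀ z, |G z| ≤ M) :
    Integrable (fun z => q ^ zinv z * G z) (Measure.pi fun _ : Fin n => ν.prod ν) := by
  refine Integrable.of_bound (C := (1 + q) ^ (n * n) * M) ?_ ?_
  · have := (measurable_from_nat (mα := inferInstance) (f := fun m => (q ^ m : ℝ))).comp (measurable_zinv (n := n))
    exact (this.mul hG).aestronglyMeasurable
  · refine Eventually.of_forall fun z => ?_
    rw [Real.norm_eq_abs, abs_mul, abs_of_pos (by positivity)]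
    refine mul_le_mul ?_ (hM z) (abs_nonneg _) (by positivity)
    calc q ^ zinv z ≤ (1 + q) ^ zinv z := by gcongr; linarith
      _ ≤ (1 + q) ^ (n * n) := pow_le_pow_right₀ (by linarith) (zinv_le z)

lemma sym_int {n : ℕ} {q : ℝ} (hq : 0 < q) {G : (Fin n → ℝ × ℝ) → ℝ} (hG : Measurable G)
    {M : ℝ} (hM : ∀ z, |G z| ≤ M) :
    (n.factorial : ℝ) * ∫ z, q ^ zinv z * G z ∂(Measure.pi fun _ : Fin n => ν.prod ν)
     = ∫ z, ∑ π : Equiv.Perm (Fin n), q ^ zinv (permY π z) * G (permY π z)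
        ∂(Measure.pi fun _ : Fin n => ν.prod ν) := by
  have hi := integrable_w ν hq hG hM
  have hc : ∀ π : Equiv.Perm (Fin n),
      Integrable (fun z => q ^ zinv (permY π z) * G (permY π z))
        (Measure.pi fun _ : Fin n => ν.prod ν) :=
    fun π => (permY_mp ν π).integrable_comp_of_integrable hi
  rw [integral_finsetSum _ fun π _ => hc π]
  have : ∀ π : Equiv.Perm (Fin n), ∫ z, q ^ zinv (permY π z) * G (permY π z)
        ∂(Measure.pi fun _ : Fin n => ν.prod ν)
      = ∫ z, q ^ zinv z * G z ∂(Measure.pi fun _ : Fin n => ν.prod ν) := by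
    intro π
    conv_rhs => rw [← (permY_mp ν π).map_eq]
    rw [integral_map (measurable_permY π).aemeasurable]
    · rw [(permY_mp ν π).map_eq]
      exact hi.aestronglyMeasurable
  simp [this, Fintype.card_perm]

lemma var_count {n : ℕ} (hn : 0 < n) (f : ℝ × ℝ → ℕ) (hf : Measurable f) (hf1 : ∀ p, f p ≤ 1)
    (s : ℝ) (hs : ∫ p, (f p : ℝ) ∂(ν.prod ν) = s) :
    ∫ z, (((∑ i : Fin n, f (z i) : ℕ) : ℝ) / n - s) ^ 2
      ∂(Measure.pi fun _ : Fin n => ν.prod ν) ≤ 1 / n := by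
  have hn' : (0 : ℝ) < n := by exact_mod_cast hn
  have hfm : Measurable fun p => (f p : ℝ) :=
    (measurable_from_nat (mα := inferInstance) (f := fun m => (m : ℝ))).comp hf
  have hb : ∀ p, ‖(f p : ℝ)‖ ≤ 1 := fun p => by
    rw [Real.norm_eq_abs, abs_of_nonneg (by positivity)]; exact_mod_cast hf1 p
  have hL : MemLp (fun p => (f p : ℝ)) 2 (ν.prod ν) :=
    MemLp.of_bound hfm.aestronglyMeasurable 1 (Eventually.of_forall hb)
  have hvar := ProbabilityTheory.variance_sum_pi (μ := fun _ : Fin n => ν.prod ν)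
    (X := fun _ p => (f p : ℝ)) (fun _ => hL)
  have hv1 : ProbabilityTheory.variance (fun p => (f p : ℝ)) (ν.prod ν) ≤ 1 := by
    refine (ProbabilityTheory.variance_le_expectation_sq hfm.aestronglyMeasurable).trans ?_
    calc _ ≤ ∫ p, (1 : ℝ) ∂(ν.prod ν) := by
          refine integral_mono_of_nonneg (Eventually.of_forall fun p => sq_nonneg _)
            (integrable_const _) (Eventually.of_forall fun p => ?_)
          have := hb p
          rw [Real.norm_eq_abs] at this
          simp only [Pi.pow_apply]
          rw [← sq_abs]
          exact pow_le_one₀ (abs_nonneg _) this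
      _ = 1 := by simp
  have hIntegr : ∀ i : Fin n, ∫ z, (f (z i) : ℝ) ∂(Measure.pi fun _ : Fin n => ν.prod ν) = s := by
    intro i
    rw [← hs]
    have := (measurePreserving_eval (fun _ : Fin n => ν.prod ν) i).map_eq
    conv_rhs => rw [← this]
    rw [integral_map (measurable_pi_apply i).aemeasurable hfm.aestronglyMeasurable]
  have hii : ∀ i : Fin n, Integrable (fun z : Fin n → ℝ × ℝ => (f (z i) : ℝ))
      (Measure.pi fun _ : Fin n => ν.prod ν) := fun i =>
    Integrable.of_bound (hfm.comp (measurable_pi_apply i)).aestronglyMeasurable 1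
      (Eventually.of_forall fun z => hb _)
  have hmean : ∫ z, (∑ i : Fin n, fun z : Fin n → ℝ × ℝ => (f (z i) : ℝ)) z
      ∂(Measure.pi fun _ : Fin n => ν.prod ν) = n * s := by
    simp only [Finset.sum_apply]
    rw [integral_finsetSum _ fun i _ => hii i]
    simp [hIntegr]
  rw [ProbabilityTheory.variance_eq_integral (by
    refine Finset.aemeasurable_sum _ fun i _ => ?_
    exact (hfm.comp (measurable_pi_apply i)).aemeasurable), hmean] at hvar
  have e : ∀ z : Fin n → ℝ × ℝ, (((∑ i : Fin n, f (z i) : ℕ) : ℝ) / n - s) ^ 2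
      = (1 / (n : ℝ) ^ 2) * ((∑ i : Fin n, fun z : Fin n → ℝ × ℝ => (f (z i) : ℝ)) z - n * s) ^ 2 := by
    intro z
    simp only [Finset.sum_apply, Nat.cast_sum]
    field_simp
  simp only [e]
  rw [integral_const_mul, hvar]
  calc _ ≤ 1 / (n : ℝ) ^ 2 * ∑ _i : Fin n, 1 := by gcongr
    _ = 1 / n := by simp; field_simp

variable [NullSingletonClass ν]

lemma gibbsZ_eq (n : ℕ) (β : ℝ) :
    gibbsZ n (ν.prod ν) β = qfac (Real.exp (-β * ((n : ℝ) - 1)⁻¹)) n / n.factorial := by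
  set q := Real.exp (-β * ((n : ℝ) - 1)⁻¹) with hq
  have hq0 : 0 < q := Real.exp_pos _
  have h := sym_int ν (n := n) hq0 (G := fun _ => 1) measurable_const (M := 1) (by simp)
  simp only [mul_one] at h
  have h2 : ∫ z, ∑ π : Equiv.Perm (Fin n), q ^ zinv (permY π z)
        ∂(Measure.pi fun _ : Fin n => ν.prod ν) = qfac q n := by
    rw [integral_congr_ae (g := fun _ => qfac q n)]
    · simp
    · filter_upwards [ae_inj ν n] with z hz
      exact sum_perm_one q z hz.1 hz.2
  rw [h2] at h
  rw [eq_div_iff (by positivity), ← h, mul_comm]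
  simp only [gibbsZ, exp_ham]
  rw [← hq]

lemma gibbs_int (n : ℕ) (β : ℝ) (G : (Fin n → ℝ × ℝ) → ℝ) :
    ∫ z, G z ∂(gibbs n (ν.prod ν) β) = (gibbsZ n (ν.prod ν) β)⁻¹ *
      ∫ z, (Real.exp (-β * ((n : ℝ) - 1)⁻¹)) ^ zinv z * G z
        ∂(Measure.pi fun _ : Fin n => ν.prod ν) := by
  have hZ : 0 < gibbsZ n (ν.prod ν) β := by
    rw [gibbsZ_eq]; have := qfac_pos (Real.exp_pos (-β * ((n : ℝ) - 1)⁻¹)) n; positivity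
  have hm : Measurable fun z : Fin n → ℝ × ℝ =>
      ENNReal.ofReal (Real.exp (-β * hamiltonian n z) / gibbsZ n (ν.prod ν) β) := by
    simp only [exp_ham]
    have := (measurable_from_nat (mα := inferInstance) (f := fun m => (Real.exp (-β * ((n : ℝ) - 1)⁻¹)) ^ m)).comp
      (measurable_zinv (n := n))
    exact (this.div_const _).ennreal_ofReal
  unfold gibbs
  rw [integral_withDensity_eq_integral_toReal_smul hm (by simp), ← integral_const_mul]
  refine integral_congr_ae (Eventually.of_forall fun z => ?_)
  simp only
  rw [ENNReal.toReal_ofReal (by positivity), exp_ham, smul_eq_mul]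
  ring

lemma gibbs_prob (n : ℕ) (β : ℝ) : IsProbabilityMeasure (gibbs n (ν.prod ν) β) := by
  have hZ : 0 < gibbsZ n (ν.prod ν) β := by
    rw [gibbsZ_eq]; have := qfac_pos (Real.exp_pos (-β * ((n : ℝ) - 1)⁻¹)) n; positivity
  have h := gibbs_int ν n β (fun _ => 1)
  have h2 : ∫ z, (Real.exp (-β * ((n : ℝ) - 1)⁻¹)) ^ zinv z * 1
        ∂(Measure.pi fun _ : Fin n => ν.prod ν) = gibbsZ n (ν.prod ν) β := by
    simp only [gibbsZ, exp_ham, mul_one]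
  rw [h2, inv_mul_cancel₀ hZ.ne'] at h
  simp only [integral_const, smul_eq_mul, mul_one, Measure.real] at h
  exact ⟨by rw [← ENNReal.toReal_eq_one_iff]; exact h⟩

lemma gibbs_int_le (n : ℕ) (β : ℝ) {G K : (Fin n → ℝ × ℝ) → ℝ} (hG : Measurable G)
    {M : ℝ} (hM : ∀ z, |G z| ≤ M)
    (hK : Integrable K (Measure.pi fun _ : Fin n => ν.prod ν))
    (hGK : ∀ z : Fin n → ℝ × ℝ, (Function.Injective fun i => (z i).1) →
      (Function.Injective fun i => (z i).2) →
      ∑ π : Equiv.Perm (Fin n), (Real.exp (-β * ((n : ℝ) - 1)⁻¹)) ^ zinv (permY π z)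
        * G (permY π z) ≤ K z * qfac (Real.exp (-β * ((n : ℝ) - 1)⁻¹)) n) :
    ∫ z, G z ∂(gibbs n (ν.prod ν) β) ≤ ∫ z, K z ∂(Measure.pi fun _ : Fin n => ν.prod ν) := by
  rw [gibbs_int, gibbsZ_eq]
  set q := Real.exp (-β * ((n : ℝ) - 1)⁻¹) with hq
  have hq0 : 0 < q := Real.exp_pos _
  have hF := qfac_pos hq0 n
  have h := sym_int ν hq0 hG hM
  have hi := integrable_w ν hq0 hG hM
  have hc : ∀ π : Equiv.Perm (Fin n),
      Integrable (fun z => q ^ zinv (permY π z) * G (permY π z))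
        (Measure.pi fun _ : Fin n => ν.prod ν) :=
    fun π => (permY_mp ν π).integrable_comp_of_integrable hi
  have h2 : ∫ z, ∑ π : Equiv.Perm (Fin n), q ^ zinv (permY π z) * G (permY π z)
        ∂(Measure.pi fun _ : Fin n => ν.prod ν)
      ≤ ∫ z, K z * qfac q n ∂(Measure.pi fun _ : Fin n => ν.prod ν) := by
    refine integral_mono_ae (integrable_finsetSum _ fun π _ => hc π) (hK.mul_const _) ?_
    filter_upwards [ae_inj ν n] with z hz using hGK z hz.1 hz.2
  rw [← h, integral_mul_const] at h2
  rw [inv_div, div_mul_eq_mul_div, div_le_iff₀ hF]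
  exact h2

lemma gibbs_D {n : ℕ} (hn : 2 ≤ n) (β a b : ℝ) :
    ∫ z, Dv (Real.exp (-β * ((n : ℝ) - 1)⁻¹)) a b z ^ 2 ∂(gibbs n (ν.prod ν) β)
      ≤ n * (Real.exp |β|) ^ 2 := by
  set q := Real.exp (-β * ((n : ℝ) - 1)⁻¹) with hq
  have hq0 : 0 < q := Real.exp_pos _
  have hQ : ∀ i < n, q ^ i ≤ Real.exp |β| := by
    intro i hi
    rw [hq, ← Real.exp_nat_mul, Real.exp_le_exp]
    have hn1 : (0 : ℝ) < (n : ℝ) - 1 := by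
      have : (2 : ℝ) ≤ n := by exact_mod_cast hn
      linarith
    have hi' : (i : ℝ) * ((n : ℝ) - 1)⁻¹ ≤ 1 := by
      rw [← div_eq_mul_inv, div_le_one hn1]
      have : (i : ℝ) + 1 ≤ n := by exact_mod_cast hi
      linarith
    have hi0 : 0 ≤ (i : ℝ) * ((n : ℝ) - 1)⁻¹ := by positivity
    calc (i : ℝ) * (-β * ((n : ℝ) - 1)⁻¹) = (-β) * ((i : ℝ) * ((n : ℝ) - 1)⁻¹) := by ring
      _ ≤ |β| * ((i : ℝ) * ((n : ℝ) - 1)⁻¹) := by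
          gcongr; exact neg_le_abs β
      _ ≤ |β| * 1 := by gcongr
      _ = |β| := mul_one _
  have hn0 := qint_pos hq0 (show 0 < n by omega)
  have hDb : ∀ z : Fin n → ℝ × ℝ, |Dv q a b z ^ 2| ≤ qint q n ^ 2 := by
    intro z
    have h1 := qint_mono hq0 (cN_le a b z)
    have h2 := qint_mono hq0 (cX_le a z)
    have h3 := qint_mono hq0 (cY_le b z)
    have p1 := qint_nonneg hq0 (cN a b z)
    have p2 := qint_nonneg hq0 (cX a z)
    have p3 := qint_nonneg hq0 (cY b z)
    have h4 : qint q (cX a z) * qint q (cY b z) / qint q n ≤ qint q n := by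
      rw [div_le_iff₀ hn0]; exact mul_le_mul h2 h3 p3 hn0.le
    have h5 : 0 ≤ qint q (cX a z) * qint q (cY b z) / qint q n := by positivity
    rw [abs_of_nonneg (sq_nonneg _)]
    apply sq_le_sq'
    · unfold Dv; linarith
    · unfold Dv; linarith
  have := gibbs_int_le ν n β (G := fun z => Dv q a b z ^ 2)
    (K := fun _ => n * (Real.exp |β|) ^ 2) ((measurable_Dv q a b).pow_const 2) hDb
    (integrable_const _) (fun z h1 h2 => sum_perm_D hq0 hn hQ z h1 h2 a b)
  simpa using this

end

/-- `g(u) = ∫₀ᵘ e^{-βv} dv`. -/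
noncomputable def gf (β u : ℝ) : ℝ := if β = 0 then u else (1 - Real.exp (-β * u)) / β

lemma gf_zero (β : ℝ) : gf β 0 = 0 := by simp [gf]

lemma gf_deriv (β u : ℝ) : HasDerivAt (gf β) (Real.exp (-β * u)) u := by
  by_cases h : β = 0
  · subst h
    have : gf 0 = fun u => u := by ext u; simp [gf]
    rw [this]; simpa using hasDerivAt_id' u
  · have : gf β = fun u => (1 - Real.exp (-β * u)) / β := by ext u; simp [gf, h]
    rw [this]
    have h1 := (((hasDerivAt_id' u).const_mul (-β)).exp.const_sub 1).div_const β
    have e : -(Real.exp (-β * u) * (-β * 1)) / β = Real.exp (-β * u) := by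
      rw [div_eq_iff h]; ring
    rwa [e] at h1

lemma gf_add (β u v : ℝ) : gf β (u + v) = gf β u + Real.exp (-β * u) * gf β v := by
  by_cases h : β = 0
  · simp [gf, h]
  · simp only [gf, h, if_false]
    rw [mul_add, Real.exp_add]; field_simp; ring

lemma gf_qint (β t : ℝ) (m : ℕ) : qint (Real.exp (-β * t)) m * gf β t = gf β (m * t) := by
  induction m with
  | zero => simp [qint_zero, gf_zero]
  | succ m ih =>
    rw [qint_succ', add_mul, ih]
    push_cast
    rw [add_mul, one_mul, gf_add, ← Real.exp_nat_mul]
    congr 3; ring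

lemma gf_slope (β : ℝ) {u v : ℝ} (hu : 0 ≤ u) (hu2 : u ≤ 2) (hv : 0 ≤ v) (hv2 : v ≤ 2) :
    ∃ d, (Real.exp (2 * |β|))⁻¹ ≤ d ∧ d ≤ Real.exp (2 * |β|) ∧ gf β u - gf β v = d * (u - v) := by
  have hexp : ∀ c, 0 ≤ c → c ≤ 2 → (Real.exp (2 * |β|))⁻¹ ≤ Real.exp (-β * c) ∧
      Real.exp (-β * c) ≤ Real.exp (2 * |β|) := by
    intro c h0 h2
    have h1 : |β * c| ≤ 2 * |β| := by
      rw [abs_mul, abs_of_nonneg h0, mul_comm]; gcongr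
    have := abs_le.1 h1
    rw [← Real.exp_neg, Real.exp_le_exp, Real.exp_le_exp]
    constructor <;> linarith
  have key : ∀ u v, 0 ≤ u → v ≤ 2 → u < v → ∃ d, (Real.exp (2 * |β|))⁻¹ ≤ d ∧
      d ≤ Real.exp (2 * |β|) ∧ gf β v - gf β u = d * (v - u) := by
    intro u v hu hv h
    obtain ⟨c, hc, hc2⟩ := exists_hasDerivAt_eq_slope (gf β) (fun u => Real.exp (-β * u)) h
      (fun x _ => (gf_deriv β x).continuousAt.continuousWithinAt) (fun x _ => gf_deriv β x)
    refine ⟨Real.exp (-β * c), (hexp c (by linarith [hc.1]) (by linarith [hc.2])).1,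
      (hexp c (by linarith [hc.1]) (by linarith [hc.2])).2, ?_⟩
    rw [hc2, div_mul_cancel₀]; linarith
  rcases lt_trichotomy u v with h | h | h
  · obtain ⟨d, h1, h2, h3⟩ := key u v hu hv2 h
    exact ⟨d, h1, h2, by linarith⟩
  · subst h
    exact ⟨_, (hexp 0 le_rfl (by norm_num)).1, (hexp 0 le_rfl (by norm_num)).2, by simp⟩
  · exact key v u hv hu2 h

lemma gf_lip (β : ℝ) {u v : ℝ} (hu : 0 ≤ u) (hu2 : u ≤ 2) (hv : 0 ≤ v) (hv2 : v ≤ 2) :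
    |gf β u - gf β v| ≤ Real.exp (2 * |β|) * |u - v| := by
  obtain ⟨d, h1, h2, h3⟩ := gf_slope β hu hu2 hv hv2
  have : 0 < d := lt_of_lt_of_le (by positivity) h1
  rw [h3, abs_mul, abs_of_pos this]; gcongr

lemma gf_lower (β : ℝ) {u v : ℝ} (hu : 0 ≤ u) (hu2 : u ≤ 2) (hv : 0 ≤ v) (hv2 : v ≤ 2) :
    |u - v| ≤ Real.exp (2 * |β|) * |gf β u - gf β v| := by
  obtain ⟨d, h1, h2, h3⟩ := gf_slope β hu hu2 hv hv2
  have : 0 < d := lt_of_lt_of_le (by positivity) h1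
  rw [h3, abs_mul, abs_of_pos this, ← mul_assoc]
  have : 1 ≤ Real.exp (2 * |β|) * d := by
    rwa [inv_le_iff_one_le_mul₀' (by positivity)] at h1
  nlinarith [abs_nonneg (u - v)]

lemma gf_abs (β : ℝ) {u : ℝ} (hu : 0 ≤ u) (hu2 : u ≤ 2) :
    |gf β u| ≤ 2 * Real.exp (2 * |β|) := by
  have h := gf_lip β hu hu2 (le_refl 0) (by norm_num)
  rw [gf_zero, sub_zero, sub_zero, abs_of_nonneg hu] at h
  have : 0 < Real.exp (2 * |β|) := by positivity
  nlinarith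

lemma stab (β : ℝ) {N k l n s t r : ℝ} (hN : 0 ≤ N) (hN2 : N ≤ 2) (hk : 0 ≤ k) (hk2 : k ≤ 2)
    (hl : 0 ≤ l) (hl2 : l ≤ 2) (hn : 0 ≤ n) (hn2 : n ≤ 2) (hs : 0 ≤ s) (hs1 : s ≤ 1) (ht : 0 ≤ t)
    (ht1 : t ≤ 1) (hr : 0 ≤ r) (hr1 : r ≤ 1) (h : gf β 1 * gf β r = gf β s * gf β t) :
    |N - r| ≤ 2 * Real.exp (2 * |β|) ^ 4 *
      (|gf β n * gf β N - gf β k * gf β l| + |n - 1| + |k - s| + |l - t|) := by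
  have b1 := gf_lower β hN hN2 hr (by linarith)
  have b2 := gf_lower β (u := 1) (v := 0) (by norm_num) (by norm_num) (by norm_num) (by norm_num)
  have a1 := gf_lip β hn hn2 (v := 1) (by norm_num) (by norm_num)
  have a2 := gf_lip β hk hk2 hs (by linarith)
  have a3 := gf_lip β hl hl2 ht (by linarith)
  have c1 := gf_abs β hN hN2
  have c2 := gf_abs β hl hl2
  have c3 := gf_abs β hs (by linarith)
  rw [gf_zero, sub_zero, sub_zero, abs_one] at b2
  set B := Real.exp (2 * |β|) with hB
  have hB1 : 1 ≤ B := Real.one_le_exp (by positivity)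
  set E := gf β n * gf β N - gf β k * gf β l with hE
  have id1 : gf β 1 * (gf β N - gf β r) = -((gf β n - gf β 1) * gf β N) + E
      + (gf β k - gf β s) * gf β l + gf β s * (gf β l - gf β t) := by
    rw [mul_sub, h]; ring
  have h1 : |gf β 1 * (gf β N - gf β r)| ≤ 2 * B ^ 2 * (|E| + |n - 1| + |k - s| + |l - t|) := by
    rw [id1]
    have t1 : |(gf β n - gf β 1) * gf β N| ≤ (B * |n - 1|) * (2 * B) := by
      rw [abs_mul]; gcongr
    have t2 : |(gf β k - gf β s) * gf β l| ≤ (B * |k - s|) * (2 * B) := by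
      rw [abs_mul]; gcongr
    have t3 : |gf β s * (gf β l - gf β t)| ≤ (2 * B) * (B * |l - t|) := by
      rw [abs_mul]; gcongr
    have u1 := abs_add_le (-((gf β n - gf β 1) * gf β N) + E
      + (gf β k - gf β s) * gf β l) (gf β s * (gf β l - gf β t))
    have u2 := abs_add_le (-((gf β n - gf β 1) * gf β N) + E) ((gf β k - gf β s) * gf β l)
    have u3 := abs_add_le (-((gf β n - gf β 1) * gf β N)) E
    rw [abs_neg] at u3
    have hBB : 1 ≤ 2 * B ^ 2 := by nlinarith
    have : |E| ≤ 2 * B ^ 2 * |E| := le_mul_of_one_le_left (abs_nonneg E) hBB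
    linarith
  rw [abs_mul] at h1
  calc |N - r| ≤ B * |gf β N - gf β r| := b1
    _ ≤ B * ((B * |gf β 1|) * |gf β N - gf β r|) := by
        gcongr; nlinarith [abs_nonneg (gf β N - gf β r)]
    _ = B ^ 2 * (|gf β 1| * |gf β N - gf β r|) := by ring
    _ ≤ B ^ 2 * (2 * B ^ 2 * (|E| + |n - 1| + |k - s| + |l - t|)) := by gcongr
    _ = _ := by ring

lemma stab_arith {B D K Λ i : ℝ} (hB : 1 ≤ B) (hD : 0 ≤ D) (hK : 0 ≤ K) (hΛ : 0 ≤ Λ)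
    (hi : 0 ≤ i) : 2 * B ^ 4 * (4 * B ^ 2 * D + 2 * i + (K + 2 * i) + (Λ + 2 * i)) + 2 * i
      ≤ 16 * B ^ 6 * (D + K + Λ + i) := by
  have h6 : 1 ≤ B ^ 6 := one_le_pow₀ hB
  have h46 : B ^ 4 ≤ B ^ 6 := pow_le_pow_right₀ hB (by norm_num)
  have h1 : B ^ 4 * (12 * i + 2 * K + 2 * Λ) ≤ B ^ 6 * (12 * i + 2 * K + 2 * Λ) :=
    mul_le_mul_of_nonneg_right h46 (by positivity)
  have h2 : i ≤ B ^ 6 * i := le_mul_of_one_le_left hi h6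
  have h3 : 0 ≤ B ^ 6 * D := by positivity
  have h4 : 0 ≤ B ^ 6 * K := by positivity
  have h5 : 0 ≤ B ^ 6 * Λ := by positivity
  have h7 : 0 ≤ B ^ 6 * i := by positivity
  nlinarith

lemma stab_n (β : ℝ) {n : ℕ} (hn : 2 ≤ n) (a b : ℝ) (z : Fin n → ℝ × ℝ) {s t r : ℝ}
    (hs : 0 ≤ s) (hs1 : s ≤ 1) (ht : 0 ≤ t)
    (ht1 : t ≤ 1) (hr : 0 ≤ r) (hr1 : r ≤ 1) (h : gf β 1 * gf β r = gf β s * gf β t) :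
    |(cN a b z : ℝ) / n - r| ≤ 16 * Real.exp (2 * |β|) ^ 6 *
      (|Dv (Real.exp (-β * ((n : ℝ) - 1)⁻¹)) a b z| / n + |(cX a z : ℝ) / n - s|
        + |(cY b z : ℝ) / n - t| + 1 / n) := by
  have hn' : (2 : ℝ) ≤ n := by exact_mod_cast hn
  have hn0 : (0 : ℝ) < n := by linarith
  have hn1 : (0 : ℝ) < (n : ℝ) - 1 := by linarith
  set τ := ((n : ℝ) - 1)⁻¹ with hτ
  have hτ0 : 0 < τ := inv_pos.2 hn1
  have hτn : τ ≤ 2 * (1 / n) := by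
    rw [hτ, inv_eq_one_div, ← mul_div_assoc, div_le_div_iff₀ hn1 hn0]; linarith
  have hτ1 : τ ≤ 1 := by
    refine hτn.trans ?_
    rw [← mul_div_assoc, div_le_one hn0]; linarith
  have hnτ : n * τ - 1 = τ := by rw [hτ]; field_simp; ring
  have hm : ∀ m : ℕ, m ≤ n → 0 ≤ (m : ℝ) * τ ∧ (m : ℝ) * τ ≤ 2 ∧
      |(m : ℝ) * τ - (m : ℝ) / n| ≤ 2 * (1 / n) := by
    intro m hm
    have hm' : (m : ℝ) ≤ n := by exact_mod_cast hm
    refine ⟨by positivity, ?_, ?_⟩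
    · have : (m : ℝ) * τ ≤ n * τ := by gcongr
      linarith
    · have e : (m : ℝ) * τ - m / n = (m / n) * τ := by
        have : (m : ℝ) * τ = m / n * (n * τ) := by field_simp
        rw [this]
        have : n * τ = 1 + τ := by linarith
        rw [this]; ring
      rw [e, abs_of_nonneg (by positivity)]
      have : (m : ℝ) / n ≤ 1 := by rw [div_le_one hn0]; exact hm'
      calc (m : ℝ) / n * τ ≤ 1 * τ := by gcongr
        _ ≤ _ := by linarith
  set q := Real.exp (-β * τ) with hq
  have hq0 : 0 < q := Real.exp_pos _
  obtain ⟨N0, N2, N3⟩ := hm _ (cN_le a b z)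
  obtain ⟨k0, k2, k3⟩ := hm _ (cX_le a z)
  obtain ⟨l0, l2, l3⟩ := hm _ (cY_le b z)
  obtain ⟨n0, n2, n3⟩ := hm n le_rfl
  have st := stab β N0 N2 k0 k2 l0 l2 n0 n2 hs hs1 ht ht1 hr hr1 h
  have hqn := qint_pos hq0 (show 0 < n by omega)
  have hE : gf β (n * τ) * gf β (cN a b z * τ) - gf β (cX a z * τ) * gf β (cY b z * τ)
      = gf β (n * τ) * (Dv q a b z * gf β τ) := by
    rw [← gf_qint, ← gf_qint, ← gf_qint, ← gf_qint, Dv, ← hq]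
    field_simp
  have hB1 : 1 ≤ Real.exp (2 * |β|) := Real.one_le_exp (by positivity)
  have c1 := gf_abs β n0 n2
  have c2 := gf_lip β hτ0.le (by linarith) (le_refl 0) (by norm_num)
  rw [gf_zero, sub_zero, sub_zero, abs_of_pos hτ0] at c2
  set B := Real.exp (2 * |β|) with hB
  have hE2 : |gf β (n * τ) * gf β (cN a b z * τ) - gf β (cX a z * τ) * gf β (cY b z * τ)|
      ≤ 4 * B ^ 2 * (|Dv q a b z| / n) := by
    rw [hE, abs_mul, abs_mul]
    calc _ ≤ (2 * B) * (|Dv q a b z| * (B * (2 * (1 / n)))) := by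
          gcongr; exact c2.trans (by gcongr)
      _ = _ := by ring
  rw [hnτ, abs_of_pos hτ0] at st
  have k4 : |(cX a z : ℝ) * τ - s| ≤ |(cX a z : ℝ) / n - s| + 2 * (1 / n) := by
    have := abs_sub_le ((cX a z : ℝ) * τ) ((cX a z : ℝ) / n) s
    linarith
  have l4 : |(cY b z : ℝ) * τ - t| ≤ |(cY b z : ℝ) / n - t| + 2 * (1 / n) := by
    have := abs_sub_le ((cY b z : ℝ) * τ) ((cY b z : ℝ) / n) t
    linarith
  have N4 : |(cN a b z : ℝ) / n - r| ≤ |(cN a b z : ℝ) * τ - r| + 2 * (1 / n) := by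
    have := abs_sub_le ((cN a b z : ℝ) / n) ((cN a b z : ℝ) * τ) r
    rw [abs_sub_comm ((cN a b z : ℝ) / n) ((cN a b z : ℝ) * τ)] at this
    linarith
  set D := |Dv q a b z| / n with hD
  set K := |(cX a z : ℝ) / n - s| with hK
  set Λ := |(cY b z : ℝ) / n - t| with hΛ
  have D0 : 0 ≤ D := by positivity
  have K0 : 0 ≤ K := abs_nonneg _
  have L0 : 0 ≤ Λ := abs_nonneg _
  have i0 : (0 : ℝ) ≤ 1 / n := by positivity
  refine N4.trans (le_trans ?_ (stab_arith hB1 D0 K0 L0 i0))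
  refine add_le_add (st.trans ?_) le_rfl
  refine mul_le_mul_of_nonneg_left ?_ (by positivity)
  linarith

section
variable (ν : Measure ℝ) [IsProbabilityMeasure ν] [NullSingletonClass ν]

lemma cX_sq_bound {n : ℕ} (m : ℕ) (hm : m ≤ n) {s : ℝ} (hs : 0 ≤ s) (hs1 : s ≤ 1) :
    |((m : ℝ) / n - s) ^ 2| ≤ 1 := by
  rw [abs_of_nonneg (sq_nonneg _)]
  have h1 : (m : ℝ) / n ≤ 1 := div_le_one_of_le₀ (by exact_mod_cast hm) (by positivity)
  have h0 : 0 ≤ (m : ℝ) / n := by positivity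
  rw [sq_le_one_iff_abs_le_one, abs_le]
  constructor <;> linarith

lemma measurable_cast {X : Type*} [MeasurableSpace X] {f : X → ℕ} (hf : Measurable f) :
    Measurable fun x => (f x : ℝ) :=
  (measurable_from_nat (mα := inferInstance) (f := fun m => (m : ℝ))).comp hf

lemma gibbs_cXY {n : ℕ} (hn : 0 < n) (β s : ℝ) (hs : 0 ≤ s) (hs1 : s ≤ 1)
    (f : ℝ × ℝ → ℕ) (hf : Measurable f) (hf1 : ∀ p, f p ≤ 1)
    (hs : ∫ p, (f p : ℝ) ∂(ν.prod ν) = s) (c : (Fin n → ℝ × ℝ) → ℕ)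
    (hc : ∀ z, c z = ∑ i : Fin n, f (z i)) (hcm : Measurable c) (hcn : ∀ z, c z ≤ n)
    (hcp : ∀ π z, c (permY π z) = c z) :
    ∫ z, ((c z : ℝ) / n - s) ^ 2 ∂(gibbs n (ν.prod ν) β) ≤ 1 / n := by
  have hm : Measurable fun z => ((c z : ℝ) / n - s) ^ 2 :=
    (((measurable_cast hcm).div_const _).sub_const _).pow_const 2
  have hb : ∀ z, |((c z : ℝ) / n - s) ^ 2| ≤ 1 := fun z => cX_sq_bound _ (hcn z) ‹_› hs1
  refine (gibbs_int_le ν n β hm hb (K := fun z => ((c z : ℝ) / n - s) ^ 2) ?_ ?_).trans ?_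
  · exact Integrable.of_bound hm.aestronglyMeasurable 1 (Eventually.of_forall hb)
  · intro z h1 h2
    simp only [hcp]
    rw [← Finset.sum_mul, sum_perm_one _ z h1 h2, mul_comm]
  · simp only [hc]
    exact var_count ν hn f hf hf1 s hs

lemma gibbs_N (β a b s t r : ℝ) 
    (hs : 0 ≤ s) (hs1 : s ≤ 1) (ht : 0 ≤ t)
    (ht1 : t ≤ 1) (hr : 0 ≤ r) (hr1 : r ≤ 1) (h : gf β 1 * gf β r = gf β s * gf β t)
    (hsa : (ν (Set.Iic a)).toReal = s) (htb : (ν (Set.Iic b)).toReal = t) :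
    ∃ C : ℝ, ∀ n : ℕ, 2 ≤ n →
      ∫ z, ((cN a b z : ℝ) / n - r) ^ 2 ∂(gibbs n (ν.prod ν) β) ≤ C / n := by
  set A := 16 * Real.exp (2 * |β|) ^ 6 with hA
  refine ⟨4 * A ^ 2 * (Real.exp |β| ^ 2 + 3), fun n hn => ?_⟩
  have hn' : (2 : ℝ) ≤ n := by exact_mod_cast hn
  have hn0 : (0 : ℝ) < n := by linarith
  haveI := gibbs_prob ν n β
  set q := Real.exp (-β * ((n : ℝ) - 1)⁻¹) with hq
  have hq0 : 0 < q := Real.exp_pos _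
  have e1 := gibbs_D ν hn β a b
  rw [← hq] at e1
  have iv : ∀ a : ℝ, ∀ g : ℝ × ℝ → ℝ, Measurable g → Measure.map g (ν.prod ν) = ν →
      ∫ p, ((if g p ≤ a then 1 else 0 : ℕ) : ℝ) ∂(ν.prod ν) = (ν (Set.Iic a)).toReal := by
    intro a g hg hmap
    have : (fun p => ((if g p ≤ a then 1 else 0 : ℕ) : ℝ))
        = (g ⁻¹' Set.Iic a).indicator (fun _ => (1 : ℝ)) := by
      ext p; simp [Set.indicator]
    rw [this, integral_indicator_const _ (hg measurableSet_Iic)]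
    conv_rhs => rw [← hmap, Measure.map_apply hg measurableSet_Iic]
    simp [Measure.real]
  have e2 : ∫ z, ((cX a z : ℝ) / n - s) ^ 2 ∂(gibbs n (ν.prod ν) β) ≤ 1 / n := by
    refine gibbs_cXY ν (by omega) β s hs hs1 (fun p => if p.1 ≤ a then 1 else 0) ?_ ?_ ?_ (cX a)
      (fun z => rfl) (measurable_cX a) (cX_le a) (fun π z => cX_permY a π z)
    · exact Measurable.ite (measurableSet_le (by fun_prop) (by fun_prop)) measurable_const
        measurable_const
    · intro p; split_ifs <;> simp
    · rw [← hsa]; exact iv a Prod.fst measurable_fst (by simp [Measure.map_fst_prod])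
  have e3 : ∫ z, ((cY b z : ℝ) / n - t) ^ 2 ∂(gibbs n (ν.prod ν) β) ≤ 1 / n := by
    refine gibbs_cXY ν (by omega) β t ht ht1 (fun p => if p.2 ≤ b then 1 else 0) ?_ ?_ ?_ (cY b)
      (fun z => rfl) (measurable_cY b) (cY_le b) (fun π z => cY_permY b π z)
    · exact Measurable.ite (measurableSet_le (by fun_prop) (by fun_prop)) measurable_const
        measurable_const
    · intro p; split_ifs <;> simp
    · rw [← htb]; exact iv b Prod.snd measurable_snd (by simp [Measure.map_snd_prod])
  have i2 : Integrable (fun z => ((cX a z : ℝ) / n - s) ^ 2) (gibbs n (ν.prod ν) β) :=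
    Integrable.of_bound ((((measurable_cast (measurable_cX a)).div_const _).sub_const
      _).pow_const 2).aestronglyMeasurable 1
      (Eventually.of_forall fun z => cX_sq_bound _ (cX_le a z) hs hs1)
  have i3 : Integrable (fun z => ((cY b z : ℝ) / n - t) ^ 2) (gibbs n (ν.prod ν) β) :=
    Integrable.of_bound ((((measurable_cast (measurable_cY b)).div_const _).sub_const
      _).pow_const 2).aestronglyMeasurable 1
      (Eventually.of_forall fun z => cX_sq_bound _ (cY_le b z) ht ht1)
  have i1 : Integrable (fun z => (Dv q a b z) ^ 2) (gibbs n (ν.prod ν) β) := by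
    refine Integrable.of_bound ((measurable_Dv q a b).pow_const 2).aestronglyMeasurable
      ((qint q n) ^ 2) (Eventually.of_forall fun z => ?_)
    have hn0 := qint_pos hq0 (show 0 < n by omega)
    have h1 := qint_mono hq0 (cN_le a b z)
    have h2 := qint_mono hq0 (cX_le a z)
    have h3 := qint_mono hq0 (cY_le b z)
    have p1 := qint_nonneg hq0 (cN a b z)
    have p2 := qint_nonneg hq0 (cX a z)
    have p3 := qint_nonneg hq0 (cY b z)
    have h4 : qint q (cX a z) * qint q (cY b z) / qint q n ≤ qint q n := by
      rw [div_le_iff₀ hn0]; exact mul_le_mul h2 h3 p3 hn0.le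
    have h5 : 0 ≤ qint q (cX a z) * qint q (cY b z) / qint q n := by positivity
    rw [Real.norm_eq_abs, abs_of_nonneg (sq_nonneg _)]
    apply sq_le_sq'
    · unfold Dv; linarith
    · unfold Dv; linarith
  have hpt : ∀ z : Fin n → ℝ × ℝ, ((cN a b z : ℝ) / n - r) ^ 2 ≤
      4 * A ^ 2 * ((1 / (n : ℝ) ^ 2) * Dv q a b z ^ 2 + ((cX a z : ℝ) / n - s) ^ 2
        + ((cY b z : ℝ) / n - t) ^ 2 + 1 / (n : ℝ)) := by
    intro z
    have hst := stab_n β hn a b z hs hs1 ht ht1 hr hr1 h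
    rw [← hA, ← hq] at hst
    rw [← sq_abs, ← sq_abs ((cX a z : ℝ) / n - s), ← sq_abs ((cY b z : ℝ) / n - t),
      ← sq_abs (Dv q a b z)]
    set x := |Dv q a b z|
    set y := |(cX a z : ℝ) / n - s|
    set w := |(cY b z : ℝ) / n - t|
    have hi : (1 / (n : ℝ)) ^ 2 ≤ 1 / n := by
      have h1 : 1 / (n : ℝ) ≤ 1 := by rw [div_le_one hn0]; linarith
      have h0 : 0 ≤ 1 / (n : ℝ) := by positivity
      nlinarith
    calc |(cN a b z : ℝ) / n - r| ^ 2 ≤ (A * (x / n + y + w + 1 / n)) ^ 2 := by gcongr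
      _ = A ^ 2 * (x / n + y + w + 1 / n) ^ 2 := by ring
      _ ≤ A ^ 2 * (4 * ((x / n) ^ 2 + y ^ 2 + w ^ 2 + (1 / n) ^ 2)) := by
          gcongr
          set u := x / n
          set v := 1 / (n : ℝ)
          nlinarith [sq_nonneg (u - y), sq_nonneg (u - w), sq_nonneg (u - v), sq_nonneg (y - w),
            sq_nonneg (y - v), sq_nonneg (w - v)]
      _ = 4 * A ^ 2 * ((1 / (n : ℝ) ^ 2) * x ^ 2 + y ^ 2 + w ^ 2 + (1 / n) ^ 2) := by
          rw [div_pow]; ring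
      _ ≤ _ := by gcongr
  have hI := integral_mono_of_nonneg (μ := gibbs n (ν.prod ν) β)
    (Eventually.of_forall fun z => sq_nonneg ((cN a b z : ℝ) / n - r))
    (((((i1.const_mul (1 / (n : ℝ) ^ 2)).add i2).add i3).add (integrable_const (1 / (n : ℝ)))).const_mul
      (4 * A ^ 2)) (Eventually.of_forall hpt)
  refine hI.trans ?_
  rw [integral_const_mul]
  have hsum : ∫ z, (1 / (n : ℝ) ^ 2 * Dv q a b z ^ 2 + ((cX a z : ℝ) / n - s) ^ 2
      + ((cY b z : ℝ) / n - t) ^ 2 + 1 / (n : ℝ))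
      ∂(gibbs n (ν.prod ν) β) ≤ (Real.exp |β| ^ 2 + 3) / n := by
    have j1 := i1.const_mul (1 / (n : ℝ) ^ 2)
    have j2 : Integrable (fun z : Fin n → ℝ × ℝ => 1 / (n : ℝ) ^ 2 * Dv q a b z ^ 2
      + ((cX a z : ℝ) / n - s) ^ 2) (gibbs n (ν.prod ν) β) := j1.add i2
    have j3 : Integrable (fun z : Fin n → ℝ × ℝ => 1 / (n : ℝ) ^ 2 * Dv q a b z ^ 2
      + ((cX a z : ℝ) / n - s) ^ 2 + ((cY b z : ℝ) / n - t) ^ 2) (gibbs n (ν.prod ν) β) := j2.add i3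
    rw [integral_add j3 (integrable_const _), integral_add j2 i3, integral_add j1 i2,
      integral_const_mul]
    simp only [integral_const, probReal_univ, smul_eq_mul, one_mul]
    have : 1 / (n : ℝ) ^ 2 * ∫ z, Dv q a b z ^ 2 ∂(gibbs n (ν.prod ν) β)
        ≤ Real.exp |β| ^ 2 / n := by
      calc _ ≤ 1 / (n : ℝ) ^ 2 * (n * Real.exp |β| ^ 2) := by gcongr
        _ = _ := by field_simp
    calc _ ≤ Real.exp |β| ^ 2 / n + 1 / n + 1 / n + 1 / (n : ℝ) := by gcongr
      _ = _ := by ring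
  calc _ ≤ 4 * A ^ 2 * ((Real.exp |β| ^ 2 + 3) / n) := by
        gcongr
        exact hsum
    _ = _ := by ring
end

/-- Inverse function of `gf β`. -/
noncomputable def ell (β u : ℝ) : ℝ := if β = 0 then u else -Real.log (1 - β * u) / β

lemma ell_zero (β : ℝ) : ell β 0 = 0 := by simp [ell]

lemma ell_deriv (β u : ℝ) (hu : β * u < 1) : HasDerivAt (ell β) (1 / (1 - β * u)) u := by
  by_cases h : β = 0
  · subst h
    have : ell 0 = fun u => u := by ext u; simp [ell]
    rw [this]; simpa using hasDerivAt_id' u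
  · have : ell β = fun u => -Real.log (1 - β * u) / β := by ext u; simp [ell, h]
    rw [this]
    have hne : 1 - β * u ≠ 0 := by linarith
    have h1 := ((((hasDerivAt_id' u).const_mul β).const_sub 1).log hne).neg.div_const β
    have e : -(-(β * 1) / (1 - β * u)) / β = 1 / (1 - β * u) := by
      field_simp
    rwa [e] at h1

lemma gf_ell (β u : ℝ) (hu : β * u < 1) : gf β (ell β u) = u := by
  by_cases h : β = 0
  · simp [gf, ell, h]
  · simp only [gf, ell, h, if_false]
    have : -β * (-Real.log (1 - β * u) / β) = Real.log (1 - β * u) := by field_simp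
    rw [this, Real.exp_log (by linarith)]
    field_simp; ring

lemma ell_mono (β : ℝ) {u v : ℝ} (huv : u ≤ v) (hu : β * u < 1) (hv : β * v < 1) :
    ell β u ≤ ell β v := by
  rcases lt_trichotomy β 0 with h | h | h
  · simp only [ell, h.ne, if_false]
    rw [div_le_div_right_of_neg h]
    apply neg_le_neg
    exact Real.log_le_log (by linarith) (by nlinarith)
  · simp [ell, h, huv]
  · simp only [ell, h.ne', if_false]
    rw [div_le_div_iff_of_pos_right h]
    apply neg_le_neg
    exact Real.log_le_log (by linarith) (by nlinarith)

lemma gf_one_pos (β : ℝ) : 0 < gf β 1 := by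
  rcases lt_trichotomy β 0 with h | h | h
  · simp only [gf, h.ne, if_false]
    apply div_pos_of_neg_of_neg _ h
    have : 1 < Real.exp (-β * 1) := Real.one_lt_exp_iff.2 (by linarith)
    linarith
  · simp [gf, h]
  · simp only [gf, h.ne', if_false]
    apply div_pos _ h
    have : Real.exp (-β * 1) < 1 := Real.exp_lt_one_iff.2 (by linarith)
    linarith

lemma mul_gf_one (β : ℝ) : β * gf β 1 = 1 - Real.exp (-β) := by
  by_cases h : β = 0
  · simp [h]
  · simp only [gf, h, if_false]; field_simp

lemma ell_gf_one (β : ℝ) : ell β (gf β 1) = 1 := by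
  by_cases h : β = 0
  · simp [gf, ell, h]
  · have := mul_gf_one β
    simp only [ell, h, if_false, this]
    simp [h]

lemma mul_lt_one_of_le {β v : ℝ} (h0 : 0 ≤ v) (h1 : v ≤ gf β 1) : β * v < 1 := by
  have h2 := mul_gf_one β
  have h3 := Real.exp_pos (-β)
  rcases le_total 0 β with h | h
  · nlinarith
  · nlinarith

lemma ell_mem {β v : ℝ} (h0 : 0 ≤ v) (h1 : v ≤ gf β 1) : 0 ≤ ell β v ∧ ell β v ≤ 1 := by
  constructor
  · rw [← ell_zero β]; exact ell_mono β h0 (by simp) (mul_lt_one_of_le h0 h1)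
  · rw [← ell_gf_one β]
    exact ell_mono β h1 (mul_lt_one_of_le h0 h1) (mul_lt_one_of_le (gf_one_pos β).le le_rfl)

lemma Lb_eq (β : ℝ) : Lb β = Real.sqrt (gf β 1) := by
  by_cases h : β = 0
  · simp [Lb, gf, h]
  · simp [Lb, gf, h]

lemma Lb_pos (β : ℝ) : 0 < Lb β := by rw [Lb_eq]; exact Real.sqrt_pos.2 (gf_one_pos β)

lemma Lb_mul (β : ℝ) : Lb β * Lb β = gf β 1 := by
  rw [Lb_eq]; exact Real.mul_self_sqrt (gf_one_pos β).le

lemma lint_ftc {c : ℝ} (hc : 0 ≤ c) (f F : ℝ → ℝ)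
    (hd : ∀ x ∈ Set.Icc 0 c, HasDerivAt F (f x) x) (hf : ContinuousOn f (Set.Icc 0 c))
    (hnn : ∀ x ∈ Set.Icc 0 c, 0 ≤ f x) :
    ∫⁻ x in Set.Ioc 0 c, ENNReal.ofReal (f x) = ENNReal.ofReal (F c - F 0) := by
  have hi : IntervalIntegrable f volume 0 c := by
    apply ContinuousOn.intervalIntegrable; rwa [Set.uIcc_of_le hc]
  have h := intervalIntegral.integral_eq_sub_of_hasDerivAt (f := F) (f' := f) (a := 0) (b := c)
    (by rwa [Set.uIcc_of_le hc]) hi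
  rw [← h, intervalIntegral.integral_of_le hc, ofReal_integral_eq_lintegral_ofReal]
  · exact (intervalIntegrable_iff_integrableOn_Ioc_of_le hc).1 hi
  · exact (ae_restrict_iff' measurableSet_Ioc).2
      (Eventually.of_forall fun x hx => hnn x (Set.Ioc_subset_Icc_self hx))

lemma lambda_core (β c : ℝ) (hc : 0 ≤ c) (hcL : c ≤ Lb β) :
    ∫⁻ x in Set.Ioc 0 c, ENNReal.ofReal (Lb β / (1 - β * Lb β * x))
      = ENNReal.ofReal (ell β (Lb β * c)) := by
  have hL := Lb_pos β
  have hlt : ∀ x ∈ Set.Icc 0 c, β * (Lb β * x) < 1 := fun x hx =>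
    mul_lt_one_of_le (mul_nonneg hL.le hx.1)
      (by rw [← Lb_mul]; exact mul_le_mul_of_nonneg_left (hx.2.trans hcL) hL.le)
  rw [lint_ftc hc (fun x => Lb β / (1 - β * Lb β * x)) (fun x => ell β (Lb β * x))]
  · simp [ell_zero]
  · intro x hx
    have h1 := (ell_deriv β (Lb β * x) (hlt x hx)).comp x ((hasDerivAt_id' x).const_mul (Lb β))
    have e : 1 / (1 - β * (Lb β * x)) * (Lb β * 1) = Lb β / (1 - β * Lb β * x) := by
      rw [mul_assoc β]; ring
    rw [e] at h1
    exact h1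
  · refine ContinuousOn.div continuousOn_const (by fun_prop) fun x hx => ?_
    have := hlt x hx
    rw [mul_assoc]; linarith
  · intro x hx
    have := hlt x hx
    apply div_nonneg hL.le
    rw [mul_assoc]; linarith

lemma sigma_core (β c d : ℝ) (hc : 0 ≤ c) (hcL : c ≤ Lb β) (hd : 0 ≤ d) (hdL : d ≤ Lb β) :
    ∫⁻ p, ENNReal.ofReal (((1 - β * p.1 * p.2) ^ 2)⁻¹)
      ∂((volume : Measure ℝ).restrict (Set.Ioc 0 c)).prod
        ((volume : Measure ℝ).restrict (Set.Ioc 0 d))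
      = ENNReal.ofReal (ell β (c * d)) := by
  have hL := Lb_pos β
  have hlt : ∀ x ∈ Set.Icc 0 c, ∀ y ∈ Set.Icc 0 d, β * (x * y) < 1 := fun x hx y hy =>
    mul_lt_one_of_le (mul_nonneg hx.1 hy.1)
      (by rw [← Lb_mul]; exact mul_le_mul (hx.2.trans hcL) (hy.2.trans hdL) hy.1 hL.le)
  rw [lintegral_prod _ (by fun_prop)]
  have inner : ∀ x ∈ Set.Ioc 0 c, ∫⁻ y in Set.Ioc 0 d,
      ENNReal.ofReal (((1 - β * x * y) ^ 2)⁻¹) = ENNReal.ofReal (d / (1 - β * (x * d))) := by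
    intro x hx
    have hx' := Set.Ioc_subset_Icc_self hx
    have hne : ∀ y ∈ Set.Icc 0 d, 0 < 1 - β * x * y := fun y hy => by
      have := hlt x hx' y hy
      rw [mul_assoc]; linarith
    rw [lint_ftc hd (fun y => ((1 - β * x * y) ^ 2)⁻¹) (fun y => y / (1 - β * x * y))]
    · simp [mul_assoc]
    · intro y hy
      have h0 := (hne y hy).ne'
      have h1 := (hasDerivAt_id' y).div (((hasDerivAt_id' y).const_mul (β * x)).const_sub 1) h0
      have e : (1 * (1 - β * x * y) - y * -(β * x * 1)) / (1 - β * x * y) ^ 2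
          = ((1 - β * x * y) ^ 2)⁻¹ := by
        rw [inv_eq_one_div]; congr 1; ring
      rw [e] at h1
      exact h1
    · refine ContinuousOn.inv₀ (by fun_prop) fun y hy => ?_
      exact pow_ne_zero _ (hne y hy).ne'
    · intro y hy; positivity
  rw [setLIntegral_congr_fun measurableSet_Ioc inner]
  have hdd : d ∈ Set.Icc 0 d := ⟨hd, le_rfl⟩
  rw [lint_ftc hc (fun x => d / (1 - β * (x * d))) (fun x => ell β (x * d))]
  · simp [ell_zero]
  · intro x hx
    have h1 := (ell_deriv β (x * d) (hlt x hx d hdd)).comp x ((hasDerivAt_id' x).mul_const d)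
    have e : 1 / (1 - β * (x * d)) * (1 * d) = d / (1 - β * (x * d)) := by ring
    rw [e] at h1
    exact h1
  · refine ContinuousOn.div continuousOn_const (by fun_prop) fun x hx => ?_
    have := hlt x hx d hdd
    linarith
  · intro x hx
    have := hlt x hx d hdd
    apply div_nonneg hd
    linarith

/-- Clipping to `[0, L(β)]`. -/
noncomputable def clp (β a : ℝ) : ℝ := max 0 (min a (Lb β))

lemma clp_nonneg (β a : ℝ) : 0 ≤ clp β a := le_max_left _ _

lemma clp_le (β a : ℝ) : clp β a ≤ Lb β := max_le (Lb_pos β).le (min_le_right _ _)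

lemma Iic_inter_clp (β a : ℝ) : Set.Iic a ∩ Set.Ioc 0 (Lb β) = Set.Ioc 0 (clp β a) := by
  ext x
  simp only [clp, Set.mem_inter_iff, Set.mem_Iic, Set.mem_Ioc, le_max_iff, le_min_iff]
  constructor
  · rintro ⟨h1, h2, h3⟩; exact ⟨h2, Or.inr ⟨h1, h3⟩⟩
  · rintro ⟨h1, h2 | ⟨h2, h3⟩⟩
    · linarith
    · exact ⟨h2, h1, h3⟩

lemma res_Icc (c : ℝ) : (volume : Measure ℝ).restrict (Set.Icc 0 c)
    = (volume : Measure ℝ).restrict (Set.Ioc 0 c) :=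
  (Measure.restrict_congr_set Ioc_ae_eq_Icc).symm

lemma res_Iic (β a : ℝ) : ((volume : Measure ℝ).restrict (Set.Icc 0 (Lb β))).restrict (Set.Iic a)
    = (volume : Measure ℝ).restrict (Set.Ioc 0 (clp β a)) := by
  rw [res_Icc, Measure.restrict_restrict measurableSet_Iic, Iic_inter_clp]

lemma lambda_Iic (β a : ℝ) :
    lambdaMeasure β (Set.Iic a) = ENNReal.ofReal (ell β (Lb β * clp β a)) := by
  rw [lambdaMeasure, withDensity_apply _ measurableSet_Iic, res_Iic,
    lambda_core β _ (clp_nonneg β a) (clp_le β a)]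

instance lambda_prob (β : ℝ) : IsProbabilityMeasure (lambdaMeasure β) := by
  constructor
  rw [lambdaMeasure, withDensity_apply _ MeasurableSet.univ, Measure.restrict_univ, res_Icc,
    lambda_core β _ (Lb_pos β).le le_rfl, Lb_mul, ell_gf_one, ENNReal.ofReal_one]

instance lambda_noatom (β : ℝ) : NullSingletonClass (lambdaMeasure β) := by
  constructor
  intro x
  have h : lambdaMeasure β ≪ volume :=
    (withDensity_absolutelyContinuous _ _).trans Measure.restrict_le_self.absolutelyContinuous
  exact h (measure_singleton x)

lemma sigma_eq (β : ℝ) : sigmaMeasure β =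
    (((volume : Measure ℝ).restrict (Set.Icc 0 (Lb β))).prod
      ((volume : Measure ℝ).restrict (Set.Icc 0 (Lb β)))).withDensity
      fun p => ENNReal.ofReal (((1 - β * p.1 * p.2) ^ 2)⁻¹) := by
  rw [sigmaMeasure, Measure.prod_restrict, Set.Icc_prod_eq]
  rfl

lemma sigma_Iic (β a b : ℝ) : sigmaMeasure β (Set.Iic a ×ˢ Set.Iic b)
    = ENNReal.ofReal (ell β (clp β a * clp β b)) := by
  rw [sigma_eq, withDensity_apply _ (measurableSet_Iic.prod measurableSet_Iic),
    ← Measure.prod_restrict, res_Iic, res_Iic,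
    sigma_core β _ _ (clp_nonneg β a) (clp_le β a) (clp_nonneg β b) (clp_le β b)]

instance sigma_prob (β : ℝ) : IsProbabilityMeasure (sigmaMeasure β) := by
  constructor
  rw [sigma_eq, withDensity_apply _ MeasurableSet.univ, Measure.restrict_univ, res_Icc,
    sigma_core β _ _ (Lb_pos β).le le_rfl (Lb_pos β).le le_rfl, Lb_mul, ell_gf_one,
    ENNReal.ofReal_one]

lemma gibbs_conv (β a b : ℝ) : ∃ C : ℝ, ∀ n : ℕ, 2 ≤ n →
    ∫ z, ((cN a b z : ℝ) / n - (sigmaMeasure β).real (Set.Iic a ×ˢ Set.Iic b)) ^ 2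
      ∂(gibbs n ((lambdaMeasure β).prod (lambdaMeasure β)) β) ≤ C / n := by
  have ha0 := clp_nonneg β a
  have hb0 := clp_nonneg β b
  have haL := clp_le β a
  have hbL := clp_le β b
  have hL := Lb_pos β
  have a0 : 0 ≤ Lb β * clp β a := mul_nonneg hL.le ha0
  have b0 : 0 ≤ Lb β * clp β b := mul_nonneg hL.le hb0
  have c0 : 0 ≤ clp β a * clp β b := mul_nonneg ha0 hb0
  have a1 : Lb β * clp β a ≤ gf β 1 := by
    rw [← Lb_mul]; exact mul_le_mul_of_nonneg_left haL hL.le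
  have b1 : Lb β * clp β b ≤ gf β 1 := by
    rw [← Lb_mul]; exact mul_le_mul_of_nonneg_left hbL hL.le
  have c1 : clp β a * clp β b ≤ gf β 1 := by
    rw [← Lb_mul]; exact mul_le_mul haL hbL hb0 hL.le
  have er : (sigmaMeasure β).real (Set.Iic a ×ˢ Set.Iic b) = ell β (clp β a * clp β b) := by
    rw [Measure.real, sigma_Iic, ENNReal.toReal_ofReal (ell_mem c0 c1).1]
  rw [er]
  refine gibbs_N (lambdaMeasure β) β a b (ell β (Lb β * clp β a)) (ell β (Lb β * clp β b)) _
    (ell_mem a0 a1).1 (ell_mem a0 a1).2 (ell_mem b0 b1).1 (ell_mem b0 b1).2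
    (ell_mem c0 c1).1 (ell_mem c0 c1).2 ?_ ?_ ?_
  · rw [gf_ell _ _ (mul_lt_one_of_le a0 a1), gf_ell _ _ (mul_lt_one_of_le b0 b1),
      gf_ell _ _ (mul_lt_one_of_le c0 c1), ← Lb_mul]
    ring
  · rw [lambda_Iic, ENNReal.toReal_ofReal (ell_mem a0 a1).1]
  · rw [lambda_Iic, ENNReal.toReal_ofReal (ell_mem b0 b1).1]

/-- The lower-left quadrant at `(a, b)`. -/
def quad (a b : ℝ) : Set (ℝ × ℝ) := Set.Iic a ×ˢ Set.Iic b

lemma meas_quad (a b : ℝ) : MeasurableSet (quad a b) := measurableSet_Iic.prod measurableSet_Iic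

lemma real_strip (μ : Measure (ℝ × ℝ)) [IsFiniteMeasure μ] {a a' : ℝ} (h : a ≤ a') {T : Set ℝ}
    (hT : MeasurableSet T) :
    μ.real (Set.Ioc a a' ×ˢ T) = μ.real (Set.Iic a' ×ˢ T) - μ.real (Set.Iic a ×ˢ T) := by
  rw [← measureReal_diff (Set.prod_mono (Set.Iic_subset_Iic.2 h) le_rfl)
    (measurableSet_Iic.prod hT)]
  congr 1
  ext p
  simp only [Set.mem_prod, Set.mem_Ioc, Set.mem_Iic, Set.mem_diff, not_and]
  constructor
  · rintro ⟨⟨h1, h2⟩, h3⟩; exact ⟨⟨h2, h3⟩, fun h4 => absurd h4 (not_le.2 h1)⟩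
  · rintro ⟨⟨h1, h2⟩, h3⟩; exact ⟨⟨not_le.1 fun h4 => h3 h4 h2, h1⟩, h2⟩

lemma real_box (μ : Measure (ℝ × ℝ)) [IsFiniteMeasure μ] {a a' b b' : ℝ} (h : a ≤ a')
    (h' : b ≤ b') : μ.real (Set.Ioc a a' ×ˢ Set.Ioc b b')
      = (μ.real (quad a' b') - μ.real (quad a b')) - (μ.real (quad a' b) - μ.real (quad a b)) := by
  unfold quad
  rw [← real_strip μ h measurableSet_Iic, ← real_strip μ h measurableSet_Iic,
    ← measureReal_diff (Set.prod_mono le_rfl (Set.Iic_subset_Iic.2 h'))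
    (measurableSet_Ioc.prod measurableSet_Iic)]
  congr 1
  ext p
  simp only [Set.mem_prod, Set.mem_Ioc, Set.mem_Iic, Set.mem_diff, not_and]
  constructor
  · rintro ⟨h1, ⟨h2, h3⟩⟩; exact ⟨⟨h1, h3⟩, fun _ => not_le.2 h2⟩
  · rintro ⟨⟨h1, h2⟩, h3⟩; exact ⟨h1, not_le.1 (h3 h1), h2⟩

/-- The filter of convergence of the bivariate distribution function at rational points. -/
noncomputable def cdfFilter (σ : ProbabilityMeasure (ℝ × ℝ)) :
    Filter (ProbabilityMeasure (ℝ × ℝ)) :=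
  ⨅ p : ℚ × ℚ, comap (fun μ : ProbabilityMeasure (ℝ × ℝ) =>
    (μ : Measure (ℝ × ℝ)).real (quad p.1 p.2)) (nhds ((σ : Measure (ℝ × ℝ)).real (quad p.1 p.2)))

lemma cdfFilter_tendsto (σ : ProbabilityMeasure (ℝ × ℝ)) (a b : ℚ) :
    Tendsto (fun μ : ProbabilityMeasure (ℝ × ℝ) => (μ : Measure (ℝ × ℝ)).real (quad a b))
      (cdfFilter σ) (nhds ((σ : Measure (ℝ × ℝ)).real (quad a b))) := by
  rw [tendsto_iff_comap]
  exact iInf_le (fun p : ℚ × ℚ => comap (fun μ : ProbabilityMeasure (ℝ × ℝ) =>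
    (μ : Measure (ℝ × ℝ)).real (quad p.1 p.2))
      (nhds ((σ : Measure (ℝ × ℝ)).real (quad p.1 p.2)))) (a, b)

lemma cdfFilter_box (σ : ProbabilityMeasure (ℝ × ℝ)) {a a' b b' : ℚ} (h : a ≤ a') (h' : b ≤ b') :
    Tendsto (fun μ : ProbabilityMeasure (ℝ × ℝ) =>
      (μ : Measure (ℝ × ℝ)).real (Set.Ioc (a : ℝ) a' ×ˢ Set.Ioc (b : ℝ) b'))
      (cdfFilter σ)
      (nhds ((σ : Measure (ℝ × ℝ)).real (Set.Ioc (a : ℝ) a' ×ˢ Set.Ioc (b : ℝ) b'))) := by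
  have h1 : (a : ℝ) ≤ a' := by exact_mod_cast h
  have h2 : (b : ℝ) ≤ b' := by exact_mod_cast h'
  have e : ∀ μ : ProbabilityMeasure (ℝ × ℝ), _ := fun μ => real_box (μ : Measure (ℝ × ℝ)) h1 h2
  simp only [e]
  exact ((cdfFilter_tendsto σ a' b').sub (cdfFilter_tendsto σ a b')).sub
    ((cdfFilter_tendsto σ a' b).sub (cdfFilter_tendsto σ a b))

lemma cdfFilter_le (σ : ProbabilityMeasure (ℝ × ℝ)) : cdfFilter σ ≤ nhds σ := by
  have hcg : (cdfFilter σ).IsCountablyGenerated := by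
    unfold cdfFilter; infer_instance
  let S : Set (Set (ℝ × ℝ)) := {s | ∃ a a' b b' : ℚ, a ≤ a' ∧ b ≤ b' ∧
    s = Set.Ioc (a : ℝ) a' ×ˢ Set.Ioc (b : ℝ) b'}
  have hS : IsPiSystem S := by
    rintro - ⟨a, a', b, b', h, h', rfl⟩ - ⟨c, c', d, d', k, k', rfl⟩ ⟨p, hp⟩
    refine ⟨max a c, min a' c', max b d, min b' d', ?_, ?_, ?_⟩
    · have h1 := hp.1.1
      have h2 := hp.2.1
      have : ((max a c : ℚ) : ℝ) ≤ ((min a' c' : ℚ) : ℝ) := by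
        push_cast
        exact (max_lt h1.1 h2.1).le.trans (le_min h1.2 h2.2)
      exact_mod_cast this
    · have h1 := hp.1.2
      have h2 := hp.2.2
      have : ((max b d : ℚ) : ℝ) ≤ ((min b' d' : ℚ) : ℝ) := by
        push_cast
        exact (max_lt h1.1 h2.1).le.trans (le_min h1.2 h2.2)
      exact_mod_cast this
    · rw [Set.prod_inter_prod, Set.Ioc_inter_Ioc, Set.Ioc_inter_Ioc]
      push_cast
      rfl
  have key : Tendsto (fun μ : ProbabilityMeasure (ℝ × ℝ) => μ) (cdfFilter σ) (nhds σ) := by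
    refine hS.tendsto_probabilityMeasure_of_tendsto_of_mem ?_ ?_ ?_
    · rintro - ⟨a, a', b, b', h, h', rfl⟩
      exact measurableSet_Ioc.prod measurableSet_Ioc
    · intro u hu x hx
      obtain ⟨ε, hε, hb⟩ := Metric.isOpen_iff.1 hu x hx
      obtain ⟨a, ha, ha2⟩ := exists_rat_btwn (show x.1 - ε < x.1 by linarith)
      obtain ⟨a', ha', ha2'⟩ := exists_rat_btwn (show x.1 < x.1 + ε by linarith)
      obtain ⟨b, hb1, hb2⟩ := exists_rat_btwn (show x.2 - ε < x.2 by linarith)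
      obtain ⟨b', hb1', hb2'⟩ := exists_rat_btwn (show x.2 < x.2 + ε by linarith)
      refine ⟨_, ⟨a, a', b, b', ?_, ?_, rfl⟩, ?_, ?_⟩
      · exact_mod_cast (ha2.trans ha').le
      · exact_mod_cast (hb2.trans hb1').le
      · exact prod_mem_nhds (Ioc_mem_nhds ha2 ha') (Ioc_mem_nhds hb2 hb1')
      · refine Set.Subset.trans ?_ hb
        rintro p ⟨⟨h1, h2⟩, ⟨h3, h4⟩⟩
        rw [Metric.mem_ball, Prod.dist_eq, max_lt_iff, Real.dist_eq, Real.dist_eq, abs_lt, abs_lt]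
        refine ⟨⟨?_, ?_⟩, ?_, ?_⟩ <;> linarith
    · rintro - ⟨a, a', b, b', h, h', rfl⟩
      rw [← NNReal.tendsto_coe]
      exact cdfFilter_box σ h h'
  exact key

lemma emp_toMeasure {n : ℕ} (hn : n ≠ 0) (z : Fin n → ℝ × ℝ) :
    (empiricalPts n z : Measure (ℝ × ℝ)) = (n : ℝ≥0∞)⁻¹ • ∑ i : Fin n, Measure.dirac (z i) := by
  cases n with
  | zero => exact absurd rfl hn
  | succ m => rfl

lemma emp_quad {n : ℕ} (hn : n ≠ 0) (z : Fin n → ℝ × ℝ) (a b : ℝ) :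
    (empiricalPts n z : Measure (ℝ × ℝ)).real (quad a b) = (cN a b z : ℝ) / n := by
  rw [Measure.real, emp_toMeasure hn, Measure.smul_apply, Measure.finset_sum_apply]
  have : ∑ i : Fin n, Measure.dirac (z i) (quad a b) = (cN a b z : ℝ≥0∞) := by
    rw [cN]
    push_cast
    refine Finset.sum_congr rfl fun i _ => ?_
    rw [Measure.dirac_apply' _ (meas_quad a b)]
    simp [Set.indicator, quad, Prod.le_def]
  rw [this, smul_eq_mul, ENNReal.toReal_mul, ENNReal.toReal_inv]
  simp only [ENNReal.toReal_natCast]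
  rw [div_eq_inv_mul]

lemma emp_continuous {n : ℕ} (hn : n ≠ 0) : Continuous (empiricalPts n) := by
  rw [continuous_iff_continuousAt]
  intro z
  unfold ContinuousAt
  rw [ProbabilityMeasure.tendsto_iff_forall_integral_tendsto]
  intro f
  have e : ∀ w : Fin n → ℝ × ℝ, ∫ x, f x ∂(empiricalPts n w : Measure (ℝ × ℝ))
      = (n : ℝ)⁻¹ * ∑ i, f (w i) := by
    intro w
    rw [emp_toMeasure hn, integral_smul_measure, integral_finset_sum_measure]
    · simp
    · intro i _
      exact f.integrable _
  simp only [e]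
  have : Continuous fun w : Fin n → ℝ × ℝ => (n : ℝ)⁻¹ * ∑ i, f (w i) := by fun_prop
  exact this.tendsto z

/-- Sets which contain the empirical measure with probability tending to one. -/
noncomputable def probFilter (P : ∀ n : ℕ, Measure (Fin n → ℝ × ℝ)) :
    Filter (ProbabilityMeasure (ℝ × ℝ)) where
  sets := {U | Tendsto (fun n => P n {z | empiricalPts n z ∉ U}) atTop (nhds 0)}
  univ_sets := by simp
  sets_of_superset := by
    intro U V hU hUV
    exact tendsto_of_tendsto_of_tendsto_of_le_of_le tendsto_const_nhds hU (fun n => zero_le)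
      (fun n => measure_mono fun z hz h => hz (hUV h))
  inter_sets := by
    intro U V hU hV
    have h := hU.add hV
    rw [add_zero] at h
    refine tendsto_of_tendsto_of_tendsto_of_le_of_le tendsto_const_nhds h (fun n => zero_le)
      (fun n => le_trans (measure_mono ?_) (measure_union_le _ _))
    intro z hz
    by_contra hc
    simp only [Set.mem_union, Set.mem_setOf_eq, not_or, not_not] at hc
    exact hz ⟨hc.1, hc.2⟩

lemma mem_probFilter (P : ∀ n : ℕ, Measure (Fin n → ℝ × ℝ)) (U : Set (ProbabilityMeasure (ℝ × ℝ))) :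
    U ∈ probFilter P ↔ Tendsto (fun n => P n {z | empiricalPts n z ∉ U}) atTop (nhds 0) := Iff.rfl

lemma probFilter_le (β : ℝ) :
    probFilter (fun n => gibbs n ((lambdaMeasure β).prod (lambdaMeasure β)) β)
      ≤ cdfFilter ⟨sigmaMeasure β, sigma_prob β⟩ := by
  refine le_iInf fun p => ?_
  rw [← tendsto_iff_comap, Metric.tendsto_nhds]
  intro ε hε
  change _ ∈ probFilter _
  rw [mem_probFilter]
  obtain ⟨C, hC⟩ := gibbs_conv β p.1 p.2
  set r := (sigmaMeasure β).real (Set.Iic (p.1 : ℝ) ×ˢ Set.Iic (p.2 : ℝ)) with hr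
  have hr0 : 0 ≤ r := measureReal_nonneg
  have hr1 : r ≤ 1 := measureReal_le_one
  have hlim : Tendsto (fun n : ℕ => ENNReal.ofReal (C / n / ε ^ 2)) atTop (nhds 0) := by
    have h1 : Tendsto (fun n : ℕ => C / (n : ℝ) / ε ^ 2) atTop (nhds 0) := by
      have := (tendsto_const_div_atTop_nhds_zero_nat C).div_const (ε ^ 2)
      simpa using this
    simpa using ENNReal.tendsto_ofReal h1
  refine tendsto_of_tendsto_of_tendsto_of_le_of_le' tendsto_const_nhds hlim
    (Eventually.of_forall fun n => zero_le) ?_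
  filter_upwards [eventually_ge_atTop 2] with n hn
  have hpr := gibbs_prob (lambdaMeasure β) n β
  have hn0 : n ≠ 0 := by omega
  have hIntegr : Integrable (fun z : Fin n → ℝ × ℝ => ((cN (p.1 : ℝ) p.2 z : ℝ) / n - r) ^ 2)
      (gibbs n ((lambdaMeasure β).prod (lambdaMeasure β)) β) :=
    Integrable.of_bound ((((measurable_cast (measurable_cN (p.1 : ℝ) p.2)).div_const _).sub_const
      _).pow_const 2).aestronglyMeasurable 1
      (Eventually.of_forall fun z => cX_sq_bound _ (cN_le _ _ z) hr0 hr1)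
  have hch := mul_meas_ge_le_integral_of_nonneg
    (Eventually.of_forall fun z : Fin n → ℝ × ℝ => sq_nonneg ((cN (p.1 : ℝ) p.2 z : ℝ) / n - r))
    hIntegr (ε ^ 2)
  have hset : {z : Fin n → ℝ × ℝ | empiricalPts n z ∉ {x : ProbabilityMeasure (ℝ × ℝ) |
      dist ((x : Measure (ℝ × ℝ)).real (quad p.1 p.2)) r < ε}}
      ⊆ {z | ε ^ 2 ≤ ((cN (p.1 : ℝ) p.2 z : ℝ) / n - r) ^ 2} := by
    intro z hz
    simp only [Set.mem_setOf_eq, not_lt, emp_quad hn0, Real.dist_eq] at hz ⊢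
    rw [← sq_abs ((cN (p.1 : ℝ) p.2 z : ℝ) / n - r)]
    gcongr
  refine (measure_mono hset).trans ?_
  rw [← ENNReal.ofReal_toReal (measure_ne_top (gibbs n ((lambdaMeasure β).prod
    (lambdaMeasure β)) β) _)]
  apply ENNReal.ofReal_le_ofReal
  rw [le_div_iff₀ (by positivity), mul_comm]
  exact hch.trans (hC n hn)

lemma final_bound {X : Type*} [MeasurableSpace X] (P : Measure X) [IsProbabilityMeasure P]
    (G : X → ℝ) (hG : Measurable G) (M c ε : ℝ) (hM : ∀ x, |G x| ≤ M) (hc : |c| ≤ M) (hε : 0 ≤ ε) :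
    |∫ x, G x ∂P - c| ≤ ε + 2 * M * P.real {x | ¬ |G x - c| < ε} := by
  have hms : MeasurableSet {x | ¬ |G x - c| < ε} :=
    (measurableSet_lt (hG.sub_const c).abs measurable_const).compl
  have hGi : Integrable G P := Integrable.of_bound hG.aestronglyMeasurable M
    (Eventually.of_forall hM)
  have h1 : ∫ x, G x ∂P - c = ∫ x, (G x - c) ∂P := by
    rw [integral_sub hGi (integrable_const c)]; simp
  have hI : Integrable (fun x => {x | ¬ |G x - c| < ε}.indicator (fun _ => 2 * M) x) P :=
    (integrable_const _).indicator hms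
  rw [h1]
  calc |∫ x, (G x - c) ∂P| ≤ ∫ x, |G x - c| ∂P := abs_integral_le_integral_abs
    _ ≤ ∫ x, (ε + {x | ¬ |G x - c| < ε}.indicator (fun _ => 2 * M) x) ∂P := by
        refine integral_mono (hGi.sub (integrable_const c)).abs ((integrable_const ε).add hI) ?_
        intro x
        by_cases hx : |G x - c| < ε
        · simp only [Set.indicator, Set.mem_setOf_eq, hx, not_true, if_false]
          linarith
        · simp only [Set.indicator, Set.mem_setOf_eq, hx, not_false_eq_true, if_true]
          have := abs_sub (G x) c
          linarith [hM x]
    _ = _ := by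
        rw [integral_add (integrable_const ε) hI, integral_indicator_const _ hms]
        simp [mul_comm]

/-- For points distributed according to the Boltzmann–Gibbs measure
`μ_{n, λ_β × λ_β, β}`, the empirical measures converge in distribution, relative to the weak
topology on Borel probability measures on `ℝ²`, to the non-random measure `σ_β`. -/
theorem gibbs_empirical_convergence (β : ℝ) :
    ∃ _h : IsProbabilityMeasure (sigmaMeasure β),
      ∀ F : BoundedContinuousFunction (ProbabilityMeasure (ℝ × ℝ)) ℝ,
        Tendsto (fun n : ℕ =>
            ∫ z, F (empiricalPts n z)
              ∂(gibbs n ((lambdaMeasure β).prod (lambdaMeasure β)) β))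
          atTop (nhds (F ⟨sigmaMeasure β, _h⟩)) := by
  refine ⟨sigma_prob β, fun F => ?_⟩
  set σ : ProbabilityMeasure (ℝ × ℝ) := ⟨sigmaMeasure β, sigma_prob β⟩ with hσ
  rw [Metric.tendsto_nhds]
  intro ε hε
  have hF : {μ : ProbabilityMeasure (ℝ × ℝ) | |F μ - F σ| < ε / 2} ∈ nhds σ := by
    have h := Metric.tendsto_nhds.1 (F.continuous.tendsto σ) (ε / 2) (by linarith)
    simp only [Real.dist_eq] at h
    exact h
  have h1 := (mem_probFilter _ _).1 (probFilter_le β (cdfFilter_le σ hF))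
  have h2 : Tendsto (fun n : ℕ => 2 * ‖F‖ *
      (gibbs n ((lambdaMeasure β).prod (lambdaMeasure β)) β).real
        {z | ¬ |F (empiricalPts n z) - F σ| < ε / 2}) atTop (nhds 0) := by
    have := ((ENNReal.tendsto_toReal ENNReal.zero_ne_top).comp h1).const_mul (2 * ‖F‖)
    simpa [Measure.real] using this
  filter_upwards [eventually_ge_atTop 2, h2.eventually_lt_const (show 0 < ε / 2 by linarith)]
    with n hn hlt
  have hpr := gibbs_prob (lambdaMeasure β) n β
  rw [Real.dist_eq]
  have hb := final_bound (gibbs n ((lambdaMeasure β).prod (lambdaMeasure β)) β)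
    (fun z => F (empiricalPts n z))
    (F.continuous.comp (emp_continuous (by omega))).measurable ‖F‖ (F σ) (ε / 2)
    (fun z => F.norm_coe_le_norm _) (F.norm_coe_le_norm _) (by linarith)
  linarith
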